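/- arXiv:1106.4895 — 7 statements merged into one kernel-verified Lean document; each statement's English description precedes it below -/
import Mathlib

section
/- Let A be a positive definite real symmetric n×n matrix. The directional derivative ∂_B Θ_A vanishes identically on the upper half plane for every real symmetric n×n matrix B with tr(A⁻¹B) = 0 if and only if the series Θ_{1,1;A} vanishes identically on the upper half plane. -/
open scoped BigOperators

noncomputable section

/-- The value ᵗv A v of the quadratic form attached to the matrix `A`. -/
def QF {n : ℕ} (A : Matrix (Fin n) (Fin n) ℝ) (v : Fin n → ℝ) : ℝ :=
  ∑ i, ∑ j, A i j * v i * v j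

/-- The value ᵗv A w of the bilinear form attached to the matrix `A`. -/
def BF {n : ℕ} (A : Matrix (Fin n) (Fin n) ℝ) (v w : Fin n → ℝ) : ℝ :=
  ∑ i, ∑ j, A i j * v i * w j

/-- `q^t = exp(2 π i t τ)`. -/
def eq2 (t : ℝ) (τ : ℂ) : ℂ := Complex.exp (2 * Real.pi * Complex.I * t * τ)

/-- Coercion of an integer vector to a real vector. -/
def Zc {n : ℕ} (c : Fin n → ℤ) : Fin n → ℝ := fun i => (c i : ℝ)

section Helpers

open Matrix

lemma norm_eq2 (t : ℝ) (τ : ℂ) : ‖eq2 t τ‖ = Real.exp (-(2 * Real.pi * τ.im * t)) := by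
  rw [eq2, Complex.norm_exp]
  congr 1
  simp
  ring

lemma eq2_ofReal_mul_I (t y : ℝ) :
    eq2 t (y * Complex.I) = (Real.exp (-(2 * Real.pi * y * t)) : ℝ) := by
  rw [eq2, Complex.ofReal_exp]
  congr 1
  push_cast
  linear_combination (2 * Real.pi * t * y : ℂ) * Complex.I_mul_I

lemma eq2_add (s t : ℝ) (τ : ℂ) : eq2 (s + t) τ = eq2 s τ * eq2 t τ := by
  rw [eq2, eq2, eq2, ← Complex.exp_add]
  congr 1
  push_cast
  ring

lemma differentiable_eq2 (t : ℝ) : Differentiable ℂ (eq2 t) := by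
  unfold eq2
  fun_prop

lemma QF_eq_dotProduct {n : ℕ} (A : Matrix (Fin n) (Fin n) ℝ) (v : Fin n → ℝ) :
    QF A v = v ⬝ᵥ (A *ᵥ v) := by
  simp only [QF, dotProduct, mulVec, Finset.mul_sum]
  exact Finset.sum_congr rfl fun i _ => Finset.sum_congr rfl fun j _ => by ring

/-- A positive definite matrix factors as `PᵀP` with `P` invertible. -/
lemma exists_isUnit_transpose_mul_self {n : ℕ} {A : Matrix (Fin n) (Fin n) ℝ} (hA : A.PosDef) :
    ∃ P : Matrix (Fin n) (Fin n) ℝ, IsUnit P ∧ A = Pᵀ * P := by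
  open scoped MatrixOrder in
  obtain ⟨P, hP⟩ := CStarAlgebra.nonneg_iff_eq_star_mul_self.mp hA.posSemidef.nonneg
  rw [star_eq_conjTranspose, conjTranspose_eq_transpose_of_trivial] at hP
  refine ⟨P, ?_, hP⟩
  have hdet := (isUnit_iff_isUnit_det _).mp hA.isUnit
  rw [hP, det_mul] at hdet
  exact (isUnit_iff_isUnit_det _).mpr (isUnit_of_mul_isUnit_right hdet)

lemma exists_pos_mul_sum_sq_le_QF {n : ℕ} (hn : 0 < n) {A : Matrix (Fin n) (Fin n) ℝ}
    (hA : A.PosDef) : ∃ c > 0, ∀ v : Fin n → ℝ, c * ∑ i, v i ^ 2 ≤ QF A v := by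
  obtain ⟨P, hP, rfl⟩ := exists_isUnit_transpose_mul_self hA
  obtain ⟨K, hK, hPK⟩ := (LinearMap.injective_iff_antilipschitz (Matrix.mulVecLin P)).mp
    (mulVec_injective_of_isUnit hP)
  have hn' : (0 : ℝ) < n := by exact_mod_cast hn
  have hK' : (0 : ℝ) < K := by exact_mod_cast hK
  refine ⟨1 / (n * K ^ 2), by positivity, fun v => ?_⟩
  have hQ : QF (Pᵀ * P) v = ∑ i, (P *ᵥ v) i ^ 2 := by
    rw [QF_eq_dotProduct, ← mulVec_mulVec, dotProduct_mulVec, vecMul_transpose, dotProduct]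
    exact Finset.sum_congr rfl fun i _ => by ring
  have hle : ‖v‖ ≤ K * ‖P *ᵥ v‖ := by
    simpa using ZeroHomClass.bound_of_antilipschitz (Matrix.mulVecLin P) hPK v
  have hnorm : ‖P *ᵥ v‖ ^ 2 ≤ QF (Pᵀ * P) v := by
    rw [hQ]
    have h0 : 0 ≤ ∑ i, (P *ᵥ v) i ^ 2 := Finset.sum_nonneg fun i _ => sq_nonneg _
    rw [← Real.sq_sqrt h0]
    refine pow_le_pow_left₀ (norm_nonneg _) ?_ 2
    refine (pi_norm_le_iff_of_nonneg (Real.sqrt_nonneg _)).mpr fun i => ?_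
    rw [Real.norm_eq_abs]
    exact Real.abs_le_sqrt
      (Finset.single_le_sum (f := fun i => (P *ᵥ v) i ^ 2) (fun i _ => sq_nonneg _)
        (Finset.mem_univ i))
  have hsum : ∑ i, v i ^ 2 ≤ n * ‖v‖ ^ 2 := by
    calc ∑ i, v i ^ 2 ≤ ∑ _i : Fin n, ‖v‖ ^ 2 := by
          refine Finset.sum_le_sum fun i _ => ?_
          rw [← sq_abs, ← Real.norm_eq_abs]
          exact pow_le_pow_left₀ (norm_nonneg _) (norm_le_pi_norm v i) 2
      _ = n * ‖v‖ ^ 2 := by simp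
  have hsq : ‖v‖ ^ 2 ≤ K ^ 2 * ‖P *ᵥ v‖ ^ 2 := by
    rw [← mul_pow]
    exact pow_le_pow_left₀ (norm_nonneg _) hle 2
  rw [div_mul_eq_mul_div, one_mul, div_le_iff₀ (by positivity)]
  calc ∑ i, v i ^ 2 ≤ n * (K ^ 2 * ‖P *ᵥ v‖ ^ 2) := by
        exact hsum.trans (mul_le_mul_of_nonneg_left hsq hn'.le)
    _ ≤ n * (K ^ 2 * QF (Pᵀ * P) v) := by gcongr
    _ = _ := by ring

/-- A product of nonnegative summable functions of separate variables is summable. -/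
lemma summable_prod_apply {ι α : Type*} [Fintype ι] {f : α → ℝ} (hf0 : ∀ a, 0 ≤ f a)
    (hf : Summable f) : Summable fun x : ι → α => ∏ i, f (x i) := by
  classical
  refine summable_of_sum_le (c := ∏ _i : ι, ∑' a, f a)
    (fun x => Finset.prod_nonneg fun i _ => hf0 _) fun u => ?_
  calc ∑ x ∈ u, ∏ i, f (x i)
      ≤ ∑ x ∈ Fintype.piFinset fun i => u.image fun x => x i, ∏ i, f (x i) := by
        refine Finset.sum_le_sum_of_subset_of_nonneg (fun x hx => ?_)
          fun x _ _ => Finset.prod_nonneg fun i _ => hf0 _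
        exact Fintype.mem_piFinset.mpr fun i => Finset.mem_image_of_mem _ hx
    _ = ∏ i, ∑ a ∈ u.image fun x => x i, f a := (Finset.prod_univ_sum _ _).symm
    _ ≤ _ := Finset.prod_le_prod (fun i _ => Finset.sum_nonneg fun a _ => hf0 a)
        fun i _ => hf.sum_le_tsum _ fun a _ => hf0 a

lemma summable_exp_neg_mul_sum_sq (n : ℕ) {b : ℝ} (hb : 0 < b) :
    Summable fun l : Fin n → ℤ => Real.exp (-(b * ∑ i, Zc l i ^ 2)) := by
  have h1 : Summable fun m : ℤ => Real.exp (-(b * (m : ℝ) ^ 2)) := by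
    refine (summable_pow_mul_jacobiTheta₂_term_bound 0 (T := b / Real.pi) (by positivity)
      0).congr fun m => ?_
    rw [pow_zero, one_mul]
    congr 1
    field_simp
    ring
  refine (summable_prod_apply (ι := Fin n) (fun _ => (Real.exp_pos _).le) h1).congr fun l => ?_
  rw [← Real.exp_sum, Finset.mul_sum, Finset.sum_neg_distrib]
  rfl

lemma summable_abs_mul_exp_neg_QF {n : ℕ} (hn : 0 < n) {A : Matrix (Fin n) (Fin n) ℝ}
    (hA : A.PosDef) {a : ℝ} (ha : 0 < a) (i j : Fin n) :
    Summable fun l : Fin n → ℤ => |Zc l i * Zc l j| * Real.exp (-(a * QF A (Zc l))) := by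
  obtain ⟨c, hc, hQ⟩ := exists_pos_mul_sum_sq_le_QF hn hA
  set b := a * c / 2 with hb
  have hb0 : 0 < b := by positivity
  refine ((summable_exp_neg_mul_sum_sq n hb0).mul_left (1 / b)).of_nonneg_of_le
    (fun l => by positivity) fun l => ?_
  set s := ∑ k, Zc l k ^ 2 with hs
  have hcoord : ∀ k, Zc l k ^ 2 ≤ s := fun k =>
    Finset.single_le_sum (f := fun k => Zc l k ^ 2) (fun _ _ => sq_nonneg _) (Finset.mem_univ k)
  have habs : |Zc l i * Zc l j| ≤ s := by
    rw [abs_le]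
    constructor <;>
      nlinarith [hcoord i, hcoord j, sq_nonneg (Zc l i + Zc l j), sq_nonneg (Zc l i - Zc l j)]
  have hs0 : 0 ≤ s := (abs_nonneg _).trans habs
  have hexp : s ≤ 1 / b * Real.exp (b * s) := by
    rw [div_mul_eq_mul_div, one_mul, le_div_iff₀ hb0]
    linarith [Real.add_one_le_exp (b * s)]
  calc |Zc l i * Zc l j| * Real.exp (-(a * QF A (Zc l)))
      ≤ (1 / b * Real.exp (b * s)) * Real.exp (-(a * (c * s))) := by
        gcongr
        · exact habs.trans hexp
        · exact hQ _
    _ = 1 / b * Real.exp (-(b * s)) := by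
        rw [mul_assoc, ← Real.exp_add]
        congr 2
        rw [hb]
        ring

/-- The rank one matrix `λ ᵗλ` weighted by `q^{ᵗλAλ}`. -/
def thetaTerm {n : ℕ} (A : Matrix (Fin n) (Fin n) ℝ) (τ : ℂ) (l : Fin n → ℤ) :
    Matrix (Fin n) (Fin n) ℂ :=
  Matrix.of fun i j => ((Zc l i * Zc l j : ℝ) : ℂ) * eq2 (QF A (Zc l)) τ

/-- The matrix of second moments `∑ λ ᵗλ q^{ᵗλAλ}`. -/
def thetaMatrix {n : ℕ} (A : Matrix (Fin n) (Fin n) ℝ) (τ : ℂ) : Matrix (Fin n) (Fin n) ℂ :=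
  Matrix.of fun i j => ∑' l, thetaTerm A τ l i j

lemma norm_thetaTerm {n : ℕ} (A : Matrix (Fin n) (Fin n) ℝ) (τ : ℂ) (l : Fin n → ℤ)
    (i j : Fin n) : ‖thetaTerm A τ l i j‖ =
      |Zc l i * Zc l j| * Real.exp (-(2 * Real.pi * τ.im * QF A (Zc l))) := by
  rw [thetaTerm, of_apply, norm_mul, norm_eq2, Complex.norm_real, Real.norm_eq_abs]

lemma summable_norm_thetaTerm {n : ℕ} (hn : 0 < n) {A : Matrix (Fin n) (Fin n) ℝ}
    (hA : A.PosDef) {τ : ℂ} (hτ : 0 < τ.im) (i j : Fin n) :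
    Summable fun l => ‖thetaTerm A τ l i j‖ := by
  simp only [norm_thetaTerm]
  exact summable_abs_mul_exp_neg_QF hn hA (by positivity) i j

lemma hasSum_thetaTerm {n : ℕ} (hn : 0 < n) {A : Matrix (Fin n) (Fin n) ℝ}
    (hA : A.PosDef) {τ : ℂ} (hτ : 0 < τ.im) (i j : Fin n) :
    HasSum (fun l => thetaTerm A τ l i j) (thetaMatrix A τ i j) :=
  (summable_norm_thetaTerm hn hA hτ i j).of_norm.hasSum

lemma hasSum_mul_thetaTerm {n : ℕ} (hn : 0 < n) {A : Matrix (Fin n) (Fin n) ℝ}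
    (hA : A.PosDef) {τ : ℂ} (hτ : 0 < τ.im) (C : Matrix (Fin n) (Fin n) ℂ) (i j : Fin n) :
    HasSum (fun l => (C * thetaTerm A τ l) i j) ((C * thetaMatrix A τ) i j) := by
  simp only [mul_apply]
  exact hasSum_sum fun k _ => (hasSum_thetaTerm hn hA hτ k j).mul_left _

lemma hasSum_mul_of_hasSum {ι κ : Type*} {f : ι → ℂ} {g : κ → ℂ} {a b : ℂ} (hf : HasSum f a)
    (hg : HasSum g b) : HasSum (fun p : ι × κ => f p.1 * g p.2) (a * b) :=
  hf.mul hg (summable_mul_of_summable_norm hf.summable.norm hg.summable.norm)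

lemma hasSum_mul_thetaTerm_mul {n : ℕ} (hn : 0 < n) {A : Matrix (Fin n) (Fin n) ℝ}
    (hA : A.PosDef) {τ : ℂ} (hτ : 0 < τ.im) (C : Matrix (Fin n) (Fin n) ℂ) (i j k m : Fin n) :
    HasSum (fun p : (Fin n → ℤ) × (Fin n → ℤ) =>
        (C * thetaTerm A τ p.1) i j * (C * thetaTerm A τ p.2) k m)
      ((C * thetaMatrix A τ) i j * (C * thetaMatrix A τ) k m) := by
  exact hasSum_mul_of_hasSum (f := fun l => (C * thetaTerm A τ l) i j)
    (g := fun l => (C * thetaTerm A τ l) k m) (hasSum_mul_thetaTerm hn hA hτ C i j)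
    (hasSum_mul_thetaTerm hn hA hτ C k m)

lemma thetaMatrix_isSymm {n : ℕ} (A : Matrix (Fin n) (Fin n) ℝ) (τ : ℂ) :
    (thetaMatrix A τ).IsSymm := by
  ext i j
  simp only [thetaMatrix, thetaTerm, transpose_apply, of_apply, mul_comm (Zc _ i)]

lemma differentiableOn_thetaMatrix {n : ℕ} (hn : 0 < n) {A : Matrix (Fin n) (Fin n) ℝ}
    (hA : A.PosDef) (i j : Fin n) :
    DifferentiableOn ℂ (fun τ => thetaMatrix A τ i j) {τ | 0 < τ.im} := by
  intro τ hτ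
  have hτ' : 0 < τ.im := hτ
  have hopen : IsOpen {z : ℂ | τ.im / 2 < z.im} := isOpen_lt continuous_const Complex.continuous_im
  have hpos : ∀ l : Fin n → ℤ, 0 ≤ QF A (Zc l) := fun l => by
    obtain ⟨c, hc, hQ⟩ := exists_pos_mul_sum_sq_le_QF hn hA
    exact (mul_nonneg hc.le (Finset.sum_nonneg fun _ _ => sq_nonneg _)).trans (hQ _)
  have hdiff : DifferentiableOn ℂ (fun z => ∑' l, thetaTerm A z l i j) {z | τ.im / 2 < z.im} := by
    refine Complex.differentiableOn_tsum_of_summable_norm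
      (summable_abs_mul_exp_neg_QF hn hA (a := 2 * Real.pi * (τ.im / 2)) (by positivity) i j)
      (fun l => ((differentiable_eq2 _).const_mul _).differentiableOn) hopen fun l z hz => ?_
    rw [norm_thetaTerm]
    have hz' : τ.im / 2 ≤ z.im := le_of_lt hz
    have := hpos l
    gcongr
  exact (hdiff.differentiableAt
    (hopen.mem_nhds (half_lt_self hτ'))).differentiableWithinAt

lemma exists_thetaMatrix_eq_map_ofReal {n : ℕ} (A : Matrix (Fin n) (Fin n) ℝ) (y : ℝ) :
    ∃ R : Matrix (Fin n) (Fin n) ℝ, R.IsSymm ∧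
      thetaMatrix A (y * Complex.I) = Complex.ofRealHom.mapMatrix R := by
  have hR : thetaMatrix A (y * Complex.I) = Complex.ofRealHom.mapMatrix (Matrix.of fun i j =>
      ∑' l : Fin n → ℤ, Zc l i * Zc l j * Real.exp (-(2 * Real.pi * y * QF A (Zc l)))) := by
    ext i j
    simp only [thetaMatrix, thetaTerm, of_apply, RingHom.mapMatrix_apply, map_apply,
      eq2_ofReal_mul_I, ← Complex.ofReal_mul]
    exact (Complex.ofReal_tsum _).symm
  refine ⟨_, ?_, hR⟩
  ext i j
  simp only [transpose_apply, of_apply, mul_comm (Zc _ i)]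

lemma trace_map_mul_thetaTerm {n : ℕ} (A B : Matrix (Fin n) (Fin n) ℝ) (τ : ℂ) (l : Fin n → ℤ) :
    (Complex.ofRealHom.mapMatrix B * thetaTerm A τ l).trace =
      (QF B (Zc l) : ℂ) * eq2 (QF A (Zc l)) τ := by
  simp only [trace, diag_apply, mul_apply, RingHom.mapMatrix_apply, map_apply, thetaTerm,
    of_apply, QF, Complex.ofReal_sum, Finset.sum_mul, Complex.ofRealHom_eq_coe]
  refine Finset.sum_congr rfl fun i _ => Finset.sum_congr rfl fun j _ => ?_
  push_cast
  ring

/-- `∂_B Θ_A` is the trace of `B` against the matrix of second moments. -/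
lemma tsum_QF_mul_eq2 {n : ℕ} (hn : 0 < n) {A : Matrix (Fin n) (Fin n) ℝ} (hA : A.PosDef)
    (B : Matrix (Fin n) (Fin n) ℝ) {τ : ℂ} (hτ : 0 < τ.im) :
    ∑' l : Fin n → ℤ, ((QF B (Zc l) : ℝ) : ℂ) * eq2 (QF A (Zc l)) τ =
      (Complex.ofRealHom.mapMatrix B * thetaMatrix A τ).trace := by
  simp only [← trace_map_mul_thetaTerm A B]
  exact HasSum.tsum_eq (hasSum_sum fun i _ => hasSum_mul_thetaTerm hn hA hτ _ i i)

lemma trace_mapMatrix_ofReal {n : ℕ} (R : Matrix (Fin n) (Fin n) ℝ) :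
    (Complex.ofRealHom.mapMatrix R).trace = (R.trace : ℂ) := by
  simp [trace]

lemma trace_mul_thetaTerm_mul_mul_thetaTerm {n : ℕ} {A : Matrix (Fin n) (Fin n) ℝ}
    (hA : A.IsSymm) (τ : ℂ) (l m : Fin n → ℤ) :
    (Complex.ofRealHom.mapMatrix A * thetaTerm A τ l * (Complex.ofRealHom.mapMatrix A * thetaTerm A τ m)).trace =
      ((BF A (Zc l) (Zc m) ^ 2 : ℝ) : ℂ) * eq2 (QF A (Zc l) + QF A (Zc m)) τ := by
  have hrank : ∀ k : Fin n → ℤ, thetaTerm A τ k =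
      eq2 (QF A (Zc k)) τ • Complex.ofRealHom.mapMatrix (vecMulVec (Zc k) (Zc k)) := fun k => by
    ext i j
    simp [thetaTerm, vecMulVec_apply, mul_comm]
  have hBF : ∀ v w : Fin n → ℝ, BF A v w = v ⬝ᵥ A *ᵥ w := fun v w => by
    simp only [BF, dotProduct, mulVec, Finset.mul_sum]
    exact Finset.sum_congr rfl fun i _ => Finset.sum_congr rfl fun j _ => by ring
  have hcomm : Zc m ⬝ᵥ A *ᵥ Zc l = Zc l ⬝ᵥ A *ᵥ Zc m := by
    rw [dotProduct_mulVec, ← mulVec_transpose, hA.eq, dotProduct_comm]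
  have hreal : (A * vecMulVec (Zc l) (Zc l) * (A * vecMulVec (Zc m) (Zc m))).trace =
      BF A (Zc l) (Zc m) ^ 2 := by
    rw [mul_vecMulVec, mul_vecMulVec, vecMulVec_mul_vecMulVec, trace_vecMulVec,
      dotProduct_smul, hBF, smul_eq_mul, dotProduct_comm (A *ᵥ Zc l), hcomm, sq]
  rw [hrank l, hrank m, eq2_add, ← hreal]
  simp only [Matrix.mul_smul, Matrix.smul_mul, trace_smul, smul_eq_mul, ← map_mul,
    trace_mapMatrix_ofReal]
  ring

/-- `Θ_{1,1;A}` expressed through the matrix of second moments. -/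
lemma tsum_theta11 {n : ℕ} (hn : 0 < n) {A : Matrix (Fin n) (Fin n) ℝ} (hAsym : A.IsSymm)
    (hA : A.PosDef) {τ : ℂ} (hτ : 0 < τ.im) :
    ∑' p : (Fin n → ℤ) × (Fin n → ℤ),
        (((BF A (Zc p.1) (Zc p.2)) ^ 2
            - (1 / (n : ℝ)) * QF A (Zc p.1) * QF A (Zc p.2) : ℝ) : ℂ) *
          eq2 (QF A (Zc p.1) + QF A (Zc p.2)) τ =
      (Complex.ofRealHom.mapMatrix A * thetaMatrix A τ * (Complex.ofRealHom.mapMatrix A * thetaMatrix A τ)).trace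
        - 1 / n * (Complex.ofRealHom.mapMatrix A * thetaMatrix A τ).trace ^ 2 := by
  have hterm : ∀ p : (Fin n → ℤ) × (Fin n → ℤ),
      (((BF A (Zc p.1) (Zc p.2)) ^ 2
            - (1 / (n : ℝ)) * QF A (Zc p.1) * QF A (Zc p.2) : ℝ) : ℂ) *
          eq2 (QF A (Zc p.1) + QF A (Zc p.2)) τ =
      (Complex.ofRealHom.mapMatrix A * thetaTerm A τ p.1 *
          (Complex.ofRealHom.mapMatrix A * thetaTerm A τ p.2)).trace
        - 1 / n * ((Complex.ofRealHom.mapMatrix A * thetaTerm A τ p.1).trace *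
          (Complex.ofRealHom.mapMatrix A * thetaTerm A τ p.2).trace) := fun p => by
    rw [trace_mul_thetaTerm_mul_mul_thetaTerm hAsym, trace_map_mul_thetaTerm,
      trace_map_mul_thetaTerm, eq2_add]
    push_cast
    ring
  simp only [hterm]
  refine HasSum.tsum_eq (HasSum.sub ?_ (HasSum.mul_left _ ?_))
  · simp only [trace, diag_apply, mul_apply (M := Complex.ofRealHom.mapMatrix A * _)]
    exact hasSum_sum fun i _ => hasSum_sum fun j _ =>
      hasSum_mul_thetaTerm_mul hn hA hτ _ i j j i
  · simp only [sq, trace, diag_apply, Finset.sum_mul_sum]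
    exact hasSum_sum fun i _ => hasSum_sum fun j _ =>
      hasSum_mul_thetaTerm_mul hn hA hτ _ i i j j

/-- Equality case of the Cauchy–Schwarz inequality for the trace form attached to `A`. -/
lemma eq_smul_inv_of_trace_sq_eq {n : ℕ} (hn : 0 < n) {A R : Matrix (Fin n) (Fin n) ℝ}
    (hA : A.PosDef) (hR : R.IsSymm)
    (h : (A * R * (A * R)).trace - 1 / n * (A * R).trace ^ 2 = 0) :
    R = ((A * R).trace / n) • A⁻¹ := by
  have hdet : IsUnit A.det := (isUnit_iff_isUnit_det _).mp hA.isUnit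
  have hn' : (n : ℝ) ≠ 0 := by exact_mod_cast hn.ne'
  have hAsym : A.IsSymm := by
    rw [IsSymm, ← conjTranspose_eq_transpose_of_trivial, hA.isHermitian.eq]
  set c := (A * R).trace / n with hc
  obtain ⟨P, hP, hAP⟩ := exists_isUnit_transpose_mul_self hA
  set D := R - c • A⁻¹ with hD
  have hDsym : Dᵀ = D := by
    rw [hD, transpose_sub, transpose_smul, transpose_nonsing_inv, hR.eq, hAsym.eq]
  have hAD : A * D = A * R - c • 1 := by
    rw [hD, mul_sub, Matrix.mul_smul, mul_nonsing_inv _ hdet]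
  have htr : (A * D * (A * D)).trace = 0 := by
    rw [hAD]
    simp only [sub_mul, mul_sub, Matrix.smul_mul, Matrix.mul_smul, one_mul, mul_one, trace_sub,
      trace_smul, trace_one, Fintype.card_fin, smul_eq_mul]
    rw [← h, hc]
    field_simp
    ring
  have hPD : P * D * Pᵀ = 0 := by
    rw [← trace_conjTranspose_mul_self_eq_zero_iff, conjTranspose_eq_transpose_of_trivial,
      transpose_mul, transpose_mul, transpose_transpose, hDsym, ← htr, hAP]
    simp only [mul_assoc]
    rw [trace_mul_comm]
    simp only [mul_assoc]
    rw [trace_mul_comm]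
    simp only [mul_assoc]
  have hD0 : D = 0 := by
    have hPT : IsUnit Pᵀ := (isUnit_transpose P).mpr hP
    exact hP.mul_right_eq_zero.mp (hPT.mul_left_eq_zero.mp hPD)
  exact sub_eq_zero.mp hD0

/-- If a complex matrix is orthogonal to all real symmetric matrices `B` with `tr(A⁻¹B) = 0`, then
equality holds in the Cauchy–Schwarz inequality for the trace form attached to `A`. -/
lemma trace_sq_eq_of_forall_trace_eq_zero {n : ℕ} (hn : 0 < n) {A : Matrix (Fin n) (Fin n) ℝ}
    (hAsym : A.IsSymm) (hA : IsUnit A.det) {M : Matrix (Fin n) (Fin n) ℂ} (hM : M.IsSymm)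
    (h : ∀ B : Matrix (Fin n) (Fin n) ℝ, B.IsSymm → (A⁻¹ * B).trace = 0 →
      (Complex.ofRealHom.mapMatrix B * M).trace = 0) :
    (Complex.ofRealHom.mapMatrix A * M * (Complex.ofRealHom.mapMatrix A * M)).trace
        - 1 / n * (Complex.ofRealHom.mapMatrix A * M).trace ^ 2 = 0 := by
  have hn' : (n : ℝ) ≠ 0 := by exact_mod_cast hn.ne'
  have key : ∀ R : Matrix (Fin n) (Fin n) ℝ, R.IsSymm →
      (Complex.ofRealHom.mapMatrix (A * R * A) * M).trace =
        (((A * R).trace / n : ℝ) : ℂ) * (Complex.ofRealHom.mapMatrix A * M).trace := fun R hR => by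
    have h0 := h (A * R * A - ((A * R).trace / n) • A)
      (by
        rw [IsSymm, transpose_sub, transpose_smul, transpose_mul, transpose_mul, hAsym.eq, hR.eq,
          mul_assoc])
      (by
        rw [mul_sub, Matrix.mul_smul, nonsing_inv_mul _ hA, ← mul_assoc, ← mul_assoc,
          nonsing_inv_mul _ hA, one_mul, trace_sub, trace_smul, trace_one, Fintype.card_fin,
          smul_eq_mul, div_mul_cancel₀ _ hn', trace_mul_comm, sub_self])
    rw [map_sub, sub_mul, trace_sub, sub_eq_zero] at h0
    have hsmul : ∀ c : ℝ, Complex.ofRealHom.mapMatrix (c • A) =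
        (c : ℂ) • Complex.ofRealHom.mapMatrix A := fun c => by
      ext i j
      simp
    rw [h0, hsmul, Matrix.smul_mul, trace_smul, smul_eq_mul]
  set X := M.map Complex.re with hX
  set Y := M.map Complex.im with hY
  have hMXY : M =
      Complex.ofRealHom.mapMatrix X + Complex.I • Complex.ofRealHom.mapMatrix Y := by
    ext i j
    simp [hX, hY, mul_comm Complex.I, Complex.re_add_im]
  have hXs : X.IsSymm := hM.map _
  have hYs : Y.IsSymm := hM.map _
  have hT : (Complex.ofRealHom.mapMatrix A * M).trace =
      (A * X).trace + Complex.I * (A * Y).trace := by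
    rw [hMXY, mul_add, Matrix.mul_smul, trace_add, trace_smul, ← map_mul, ← map_mul,
      trace_mapMatrix_ofReal, trace_mapMatrix_ofReal, smul_eq_mul]
  have hQ : (Complex.ofRealHom.mapMatrix A * M * (Complex.ofRealHom.mapMatrix A * M)).trace =
      ((Complex.ofRealHom.mapMatrix (A * X * A)) * M).trace +
        Complex.I * ((Complex.ofRealHom.mapMatrix (A * Y * A)) * M).trace := by
    nth_rewrite 1 [hMXY]
    rw [mul_add, add_mul, Matrix.mul_smul, Matrix.smul_mul, trace_add, trace_smul, smul_eq_mul,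
      ← mul_assoc, ← mul_assoc, ← map_mul, ← map_mul, ← map_mul, ← map_mul]
  rw [hQ, key X hXs, key Y hYs, hT]
  push_cast
  ring

/-- A holomorphic function on the upper half plane that vanishes on the imaginary axis is zero. -/
lemma eq_zero_of_forall_ofReal_mul_I_eq_zero {f : ℂ → ℂ}
    (hf : DifferentiableOn ℂ f {τ | 0 < τ.im}) (h : ∀ y : ℝ, 0 < y → f (y * Complex.I) = 0)
    {τ : ℂ} (hτ : 0 < τ.im) : f τ = 0 := by
  have hopen : IsOpen {z : ℂ | 0 < z.im} := isOpen_lt continuous_const Complex.continuous_im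
  have hconn : IsPreconnected {z : ℂ | 0 < z.im} := (convex_halfSpace_im_gt 0).isPreconnected
  refine (hf.analyticOnNhd hopen).eqOn_zero_of_preconnected_of_frequently_eq_zero hconn
    (z₀ := ((1 : ℝ) : ℂ) * Complex.I) (by simp) ?_ hτ
  have htend : Filter.Tendsto (fun y : ℝ => (y : ℂ) * Complex.I) (nhdsWithin 1 {1}ᶜ)
      (nhdsWithin (((1 : ℝ) : ℂ) * Complex.I) {((1 : ℝ) : ℂ) * Complex.I}ᶜ) := by
    refine Filter.Tendsto.inf ?_ ?_
    · exact Continuous.tendsto (by fun_prop) 1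
    · refine Filter.tendsto_principal_principal.mpr fun y hy hyI => hy ?_
      exact Complex.ofReal_injective (mul_right_cancel₀ Complex.I_ne_zero hyI)
  refine htend.frequently (Filter.Eventually.frequently ?_)
  exact (eventually_nhdsWithin_of_eventually_nhds (lt_mem_nhds one_pos)).mono h

end Helpers

/-- For a positive definite real symmetric `n×n` matrix `A`, the directional derivative
`∂_B Θ_A` vanishes identically on the upper half plane for every real symmetric matrix `B`
with `tr(A⁻¹B) = 0` if and only if `Θ_{1,1;A}` vanishes identically on the upper half
plane. -/
theorem vanishing_differential_iff_theta11_eq_zero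
    (n : ℕ) (hn : 0 < n) (A : Matrix (Fin n) (Fin n) ℝ)
    (hAsym : A.IsSymm) (hApos : A.PosDef) :
    (∀ B : Matrix (Fin n) (Fin n) ℝ, B.IsSymm → (A⁻¹ * B).trace = 0 →
      ∀ τ : ℂ, 0 < τ.im →
        ∑' l : Fin n → ℤ, ((QF B (Zc l) : ℝ) : ℂ) * eq2 (QF A (Zc l)) τ = 0)
    ↔
    (∀ τ : ℂ, 0 < τ.im →
      ∑' p : (Fin n → ℤ) × (Fin n → ℤ),
        (((BF A (Zc p.1) (Zc p.2)) ^ 2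
            - (1 / (n : ℝ)) * QF A (Zc p.1) * QF A (Zc p.2) : ℝ) : ℂ) *
          eq2 (QF A (Zc p.1) + QF A (Zc p.2)) τ = 0) := by
  have hdet : IsUnit A.det := (Matrix.isUnit_iff_isUnit_det _).mp hApos.isUnit
  constructor
  · intro h τ hτ
    rw [tsum_theta11 hn hAsym hApos hτ]
    refine trace_sq_eq_of_forall_trace_eq_zero hn hAsym hdet (thetaMatrix_isSymm A τ) ?_
    intro B hB hAB
    rw [← tsum_QF_mul_eq2 hn hApos B hτ]
    exact h B hB hAB τ hτ
  · intro h B _ hAB τ hτ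
    rw [tsum_QF_mul_eq2 hn hApos B hτ]
    refine eq_zero_of_forall_ofReal_mul_I_eq_zero
      (f := fun z => (Complex.ofRealHom.mapMatrix B * thetaMatrix A z).trace) ?_ (fun y hy => ?_) hτ
    · simp only [Matrix.trace, Matrix.diag_apply, Matrix.mul_apply]
      exact DifferentiableOn.fun_sum fun i _ => DifferentiableOn.fun_sum fun j _ =>
        (differentiableOn_thetaMatrix hn hApos j i).const_mul _
    · obtain ⟨R, hR, hMR⟩ := exists_thetaMatrix_eq_map_ofReal A y
      have hy' : 0 < ((y : ℂ) * Complex.I).im := by simpa using hy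
      have h0 := h _ hy'
      rw [tsum_theta11 hn hAsym hApos hy', hMR, ← map_mul, ← map_mul, trace_mapMatrix_ofReal,
        trace_mapMatrix_ofReal] at h0
      have hRA := eq_smul_inv_of_trace_sq_eq hn hApos hR
        (Complex.ofReal_injective (by push_cast; exact h0))
      simp only [hMR]
      rw [← map_mul, trace_mapMatrix_ofReal, hRA, Matrix.mul_smul, Matrix.trace_smul,
        Matrix.trace_mul_comm B, hAB, smul_zero, Complex.ofReal_zero]
end
end

section
/- Let p be an odd prime, ζ = exp(2πi/p), K = ℚ(ζ) and O_K = ℤ[ζ]. Let ι: O_K → ℂ^{(p−1)/2} be the map sending x to (σ₁(x), σ₂(x), …, σ_{(p−1)/2}(x)), where σ_k is the field embedding sending ζ to ζ^k. Equip ℂ^{(p−1)/2} with the real inner product ⟨z, z′⟩ = (1/2) Σ_{i=1}^{(p−1)/2} (z_i·conj(z′_i) + conj(z_i)·z′_i), and let g: ℂ^{(p−1)/2} → ℂ^{(p−1)/2} be the linear map multiplying the i-th coordinate by ζ^i. Then for all x, y in O_K: Σ_{k=0}^{p−1} Σ_{σ ∈ Gal(K/ℚ)} ⟨g^k(ι(x)),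 ι(σ(y))⟩² = p·‖ι(x)‖²·‖ι(y)‖². -/
open scoped BigOperators

noncomputable section

/-- The primitive `p`-th root of unity `ζ = exp(2πi/p)`. -/
def zeta (p : ℕ) : ℂ := Complex.exp (2 * Real.pi * Complex.I / p)

/-- The image of the element `P(ζ) ∈ ℤ[ζ]` under the embedding sending `ζ` to `ζ^m`,
i.e. the value `P(ζ^m)`. -/
def emb (p : ℕ) (P : Polynomial ℤ) (m : ℕ) : ℂ :=
  Polynomial.aeval (zeta p ^ m) P

/-- The real inner product `⟨z,z'⟩ = (1/2) Σᵢ (zᵢ conj z'ᵢ + conj zᵢ z'ᵢ)` on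
`ℂ^{(p-1)/2}` (written as a complex number). -/
def cip (p : ℕ) (z z' : Fin ((p - 1) / 2) → ℂ) : ℂ :=
  (1 / 2 : ℂ) * ∑ i, (z i * (starRingEnd ℂ) (z' i) + (starRingEnd ℂ) (z i) * z' i)

theorem zeta_pow_eq_stdAddChar (p : ℕ) [NeZero p] (n : ℕ) :
    zeta p ^ n = ZMod.stdAddChar (n : ZMod p) := by
  have h := ZMod.stdAddChar_coe (N := p) (n : ℤ)
  push_cast at h
  rw [h, zeta, ← Complex.exp_nat_mul]
  congr 1
  ring

theorem conj_aeval_stdAddChar (p : ℕ) [NeZero p] (P : Polynomial ℤ) (m : ZMod p) :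
    (starRingEnd ℂ) (Polynomial.aeval (ZMod.stdAddChar m) P) =
      Polynomial.aeval (ZMod.stdAddChar (-m)) P := by
  rw [AddChar.map_neg_eq_conj]
  exact (Polynomial.aeval_algHom_apply (starRingEnd ℂ).toIntAlgHom _ P).symm

theorem sum_zmod_eq_sum_range {M : Type*} [AddCommMonoid M] (p : ℕ) [NeZero p] (f : ZMod p → M) :
    ∑ m : ZMod p, f m = ∑ i ∈ Finset.range p, f (i : ZMod p) := by
  refine Finset.sum_bij' (fun m _ => m.val) (fun i _ => (i : ZMod p)) ?_ ?_ ?_ ?_ ?_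
  · intro m _
    exact Finset.mem_range.2 m.val_lt
  · simp
  · simp
  · intro i hi
    exact ZMod.val_cast_of_lt (Finset.mem_range.1 hi)
  · simp

theorem sum_units_zmod_eq_sum_range {M : Type*} [AddCommGroup M] (p : ℕ) [hp : Fact p.Prime]
    (f : ZMod p → M) :
    ∑ u : (ZMod p)ˣ, f u = ∑ i ∈ Finset.range (p - 1), f ((i + 1 : ℕ) : ZMod p) := by
  have hunits : ∑ u : (ZMod p)ˣ, f u = ∑ m : {m : ZMod p // m ≠ 0}, f m :=
    Fintype.sum_equiv unitsEquivNeZero _ _ fun _ => rfl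
  have hsplit := Fintype.sum_eq_add_sum_subtype_ne f 0
  have hsucc := Finset.sum_range_succ' (fun i : ℕ => f (i : ZMod p)) (p - 1)
  rw [Nat.sub_add_cancel hp.out.one_le, add_comm] at hsucc
  rw [sum_zmod_eq_sum_range, hsucc] at hsplit
  rw [hunits]
  simpa using hsplit.symm

theorem sum_units_zmod_eq_sum_half {M : Type*} [AddCommGroup M] (p : ℕ) [hp : Fact p.Prime]
    (hodd : Odd p) (f : ZMod p → M) :
    ∑ u : (ZMod p)ˣ, f u =
      ∑ i : Fin ((p - 1) / 2), (f ((i + 1 : ℕ) : ZMod p) + f (-((i + 1 : ℕ) : ZMod p))) := by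
  obtain ⟨h, rfl⟩ := hodd
  rw [sum_units_zmod_eq_sum_range,
    Fin.sum_univ_eq_sum_range (fun i => f ((i + 1 : ℕ) : ZMod (2 * h + 1)) +
      f (-((i + 1 : ℕ) : ZMod (2 * h + 1)))),
    show 2 * h + 1 - 1 = h + h by omega, show (h + h) / 2 = h by omega,
    Finset.sum_range_add, Finset.sum_add_distrib]
  congr 1
  rw [← Finset.sum_range_reflect]
  refine Finset.sum_congr rfl fun i hi => ?_
  congr 1
  rw [eq_neg_iff_add_eq_zero, ← Nat.cast_add, ZMod.natCast_eq_zero_iff]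
  have := Finset.mem_range.1 hi
  exact dvd_of_eq (by omega)

theorem cip_eq_sum_units (p : ℕ) [Fact p.Prime] (hodd : Odd p) (F G : ZMod p → ℂ)
    (hF : ∀ m, (starRingEnd ℂ) (F m) = F (-m)) (hG : ∀ m, (starRingEnd ℂ) (G m) = G (-m)) :
    cip p (fun i => F ((i + 1 : ℕ) : ZMod p)) (fun i => G ((i + 1 : ℕ) : ZMod p)) =
      (1 / 2 : ℂ) * ∑ u : (ZMod p)ˣ, F u * G (-u) := by
  rw [sum_units_zmod_eq_sum_half p hodd fun m => F m * G (-m)]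
  simp only [cip, hF, hG, neg_neg]

theorem sum_sq_twisted_sum_units (p : ℕ) [Fact p.Prime] (c : (ZMod p)ˣ → ℂ) :
    ∑ k : ZMod p, (∑ u : (ZMod p)ˣ, ZMod.stdAddChar (k * (u : ZMod p)) * c u) ^ 2 =
      p * ∑ u : (ZMod p)ˣ, c u * c (-u) := by
  have hterm (u v : (ZMod p)ˣ) :
      ∑ k : ZMod p, ZMod.stdAddChar (k * (u : ZMod p)) * c u * (ZMod.stdAddChar (k * (v : ZMod p)) * c v) =
        if v = -u then p * (c u * c v) else 0 := by
    have hsum := AddChar.sum_mulShift ((u : ZMod p) + v) (ZMod.isPrimitive_stdAddChar p)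
    have hiff : (u : ZMod p) + v = 0 ↔ v = -u := by
      rw [add_comm, ← eq_neg_iff_add_eq_zero, ← Units.val_neg, Units.val_inj]
    calc
      _ = (∑ k : ZMod p, ZMod.stdAddChar (k * ((u : ZMod p) + (v : ZMod p)))) * (c u * c v) := by
        rw [Finset.sum_mul]
        refine Finset.sum_congr rfl fun k _ => ?_
        rw [mul_add, AddChar.map_add_eq_mul]
        ring
      _ = _ := by
        rw [hsum]
        simp only [hiff, ZMod.card]
        split_ifs <;> simp
  simp_rw [sq, Finset.sum_mul_sum]
  rw [Finset.sum_comm, Finset.mul_sum]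
  refine Finset.sum_congr rfl fun u _ => ?_
  rw [Finset.sum_comm]
  simp [hterm]

/-- Let `p` be an odd prime, `ζ = exp(2πi/p)`, `K = ℚ(ζ)`, `O_K = ℤ[ζ]`.  Every element of
`O_K` is of the form `P(ζ)` with `P ∈ ℤ[X]`; the Minkowski embedding is
`ι(P(ζ)) = (P(ζ¹), …, P(ζ^{(p-1)/2}))`, the Galois group consists of the automorphisms
`σ_j : ζ ↦ ζ^j` for `j = 1, …, p-1`, and `g` multiplies the `i`-th coordinate by `ζ^i`.
Then for all `x = P(ζ)`, `y = R(ζ)` in `O_K`: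
`Σ_{k=0}^{p-1} Σ_{σ ∈ Gal(K/ℚ)} ⟨gᵏ(ι(x)), ι(σ(y))⟩² = p ‖ι(x)‖² ‖ι(y)‖²`. -/
theorem cyclotomic_sum_of_squares_of_inner_products
    (p : ℕ) (hp : p.Prime) (hodd : Odd p) (P R : Polynomial ℤ) :
    ∑ k : Fin p, ∑ j : Fin (p - 1),
      (cip p (fun i => zeta p ^ (((i : ℕ) + 1) * (k : ℕ)) * emb p P ((i : ℕ) + 1))
             (fun i => emb p R (((i : ℕ) + 1) * ((j : ℕ) + 1)))) ^ 2
      = (p : ℂ) * cip p (fun i => emb p P ((i : ℕ) + 1)) (fun i => emb p P ((i : ℕ) + 1))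
               * cip p (fun i => emb p R ((i : ℕ) + 1)) (fun i => emb p R ((i : ℕ) + 1)) := by
  have : Fact p.Prime := ⟨hp⟩
  let a (m : ZMod p) : ℂ := Polynomial.aeval (ZMod.stdAddChar m) P
  let b (m : ZMod p) : ℂ := Polynomial.aeval (ZMod.stdAddChar m) R
  have ha (m) : (starRingEnd ℂ) (a m) = a (-m) := conj_aeval_stdAddChar p P m
  have hb (m) : (starRingEnd ℂ) (b m) = b (-m) := conj_aeval_stdAddChar p R m
  have hP (n : ℕ) : emb p P n = a n := by simp only [emb, a, zeta_pow_eq_stdAddChar]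
  have hR (n : ℕ) : emb p R n = b n := by simp only [emb, b, zeta_pow_eq_stdAddChar]
  have hinner (k j : ℕ) :
      cip p (fun i => zeta p ^ (((i : ℕ) + 1) * k) * emb p P ((i : ℕ) + 1))
          (fun i => emb p R (((i : ℕ) + 1) * (j + 1))) =
        (1 / 2 : ℂ) * ∑ u : (ZMod p)ˣ, ZMod.stdAddChar ((k : ZMod p) * (u : ZMod p)) *
          (a u * b (-u * ((j + 1 : ℕ) : ZMod p))) := by
    have h := cip_eq_sum_units p hodd (fun m => ZMod.stdAddChar ((k : ZMod p) * m) * a m)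
      (fun m => b (m * ((j + 1 : ℕ) : ZMod p)))
      (fun m => by rw [map_mul, ha, ← AddChar.map_neg_eq_conj, mul_neg])
      (fun m => by rw [hb, neg_mul])
    simp only [hP, hR, zeta_pow_eq_stdAddChar, Nat.cast_mul, mul_comm _ (k : ZMod p),
      ← mul_assoc] at h ⊢
    exact h
  simp only [hinner]
  simp only [hP, hR]
  rw [cip_eq_sum_units p hodd a a ha ha, cip_eq_sum_units p hodd b b hb hb, Finset.sum_comm,
    Fin.sum_univ_eq_sum_range (fun j => ∑ k : Fin p, ((1 / 2 : ℂ) * ∑ u : (ZMod p)ˣ,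
      ZMod.stdAddChar (((k : ℕ) : ZMod p) * (u : ZMod p)) *
        (a u * b (-u * ((j + 1 : ℕ) : ZMod p)))) ^ 2),
    ← sum_units_zmod_eq_sum_range p (fun w => ∑ k : Fin p, ((1 / 2 : ℂ) * ∑ u : (ZMod p)ˣ,
      ZMod.stdAddChar (((k : ℕ) : ZMod p) * (u : ZMod p)) * (a u * b (-u * w))) ^ 2)]
  have hk (w : (ZMod p)ˣ) : ∑ k : Fin p, ((1 / 2 : ℂ) * ∑ u : (ZMod p)ˣ,
      ZMod.stdAddChar (((k : ℕ) : ZMod p) * (u : ZMod p)) * (a u * b (-u * w))) ^ 2 =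
      (1 / 4 : ℂ) * (p * ∑ u : (ZMod p)ˣ, a u * a (-u) * (b (u * w) * b (-(u * w)))) := by
    rw [Fin.sum_univ_eq_sum_range (fun k => ((1 / 2 : ℂ) * ∑ u : (ZMod p)ˣ,
      ZMod.stdAddChar ((k : ZMod p) * (u : ZMod p)) * (a u * b (-u * w))) ^ 2),
      ← sum_zmod_eq_sum_range p fun k => ((1 / 2 : ℂ) * ∑ u : (ZMod p)ˣ,
        ZMod.stdAddChar (k * (u : ZMod p)) * (a u * b (-u * w))) ^ 2]
    simp_rw [mul_pow]
    rw [← Finset.mul_sum, sum_sq_twisted_sum_units p fun u => a u * b (-u * w)]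
    norm_num only [Units.val_neg, neg_neg, neg_mul]
    congr 2
    refine Finset.sum_congr rfl fun u _ => ?_
    ring
  have hw (u : (ZMod p)ˣ) : ∑ w : (ZMod p)ˣ, b (u * w) * b (-(u * w)) =
      ∑ w : (ZMod p)ˣ, b w * b (-w) :=
    Fintype.sum_equiv (Equiv.mulLeft u) _ _ fun w => by simp
  simp only [hk]
  rw [← Finset.mul_sum, ← Finset.mul_sum, Finset.sum_comm]
  simp only [← Finset.mul_sum, hw]
  rw [← Finset.sum_mul]
  ring
end
end

section
/- Let p be an odd prime and let n = p − 1. Let A be the n×n matrix with diagonal entries (p−1)/2 and all off-diagonal entries −1/2, i.e. A = (1/2)(p·Id − J) where J is the all-ones matrix. Then the series Θ_{1,1;A} vanishes identically on the upper half plane. -/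
open scoped BigOperators

noncomputable section

/-- The Gram matrix `A_p = (1/2)(p·Id − J)` of size `(p-1) × (p-1)`: diagonal entries
`(p-1)/2`, off-diagonal entries `-1/2`. -/
def Ap (p : ℕ) : Matrix (Fin (p - 1)) (Fin (p - 1)) ℝ :=
  fun i j => if i = j then ((p : ℝ) - 1) / 2 else -(1 / 2)

/-- The average over all permutations of `b (σ i) * b (σ j)`, for a vector `b` of sum zero. -/
theorem sum_perm_mul_eq {n : ℕ} (b : Fin (n + 1) → ℝ) (hb : ∑ k, b k = 0)
    (i j : Fin (n + 1)) :
    n * ∑ σ : Equiv.Perm (Fin (n + 1)), b (σ i) * b (σ j) =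
      (if i = j then (n : ℝ) else -1) * (n.factorial * ∑ k, b k ^ 2) := by
  set c : Fin (n + 1) → Fin (n + 1) → ℝ :=
    fun i j => ∑ σ : Equiv.Perm (Fin (n + 1)), b (σ i) * b (σ j) with hc
  have hinv (τ : Equiv.Perm (Fin (n + 1))) (i j) : c (τ i) (τ j) = c i j :=
    Equiv.sum_comp (Equiv.mulRight τ) fun σ : Equiv.Perm (Fin (n + 1)) => b (σ i) * b (σ j)
  have hdiag (i) : c i i = n.factorial * ∑ k, b k ^ 2 := by
    have hsum : ∑ k, c k k = (n + 1).factorial * ∑ k, b k ^ 2 := by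
      have hσ (σ : Equiv.Perm (Fin (n + 1))) : ∑ k, b (σ k) * b (σ k) = ∑ k, b k ^ 2 := by
        simpa only [pow_two] using Equiv.sum_comp σ fun k => b k * b k
      simp only [hc]
      rw [Finset.sum_comm]
      simp [hσ, Fintype.card_perm]
    have hconst (k) : c k k = c i i := by
      simpa using hinv (Equiv.swap i k) i i
    simp only [hconst, Finset.sum_const, Finset.card_univ, Fintype.card_fin, nsmul_eq_mul,
      Nat.factorial_succ, Nat.cast_mul, mul_assoc] at hsum
    exact mul_left_cancel₀ (by positivity) hsum
  change n * c i j = _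
  split_ifs with hij
  · rw [← hij, hdiag]
  · have hrow : ∑ k, c i k = 0 := by
      have hσ (σ : Equiv.Perm (Fin (n + 1))) : ∑ k, b (σ k) = 0 := by
        rw [Equiv.sum_comp σ b, hb]
      simp only [hc]
      rw [Finset.sum_comm]
      simp [← Finset.mul_sum, hσ]
    have hconst (k) (hk : k ∈ Finset.univ.erase i) : c i k = c i j := by
      have h := hinv (Equiv.swap j k) i j
      rwa [Equiv.swap_apply_left, Equiv.swap_apply_of_ne_of_ne hij
        (Finset.ne_of_mem_erase hk).symm] at h
    rw [← Finset.add_sum_erase _ _ (Finset.mem_univ i), Finset.sum_congr rfl hconst, hdiag] at hrow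
    simp at hrow
    linarith

/-- The second moment of the permutation orbit of a vector of sum zero. -/
theorem sum_perm_inner_sq {n : ℕ} (a b : Fin (n + 1) → ℝ) (ha : ∑ k, a k = 0)
    (hb : ∑ k, b k = 0) :
    n * ∑ σ : Equiv.Perm (Fin (n + 1)), (∑ k, a k * b (σ k)) ^ 2 =
      (n + 1).factorial * ((∑ k, a k ^ 2) * ∑ k, b k ^ 2) := by
  have hexp : n * ∑ σ : Equiv.Perm (Fin (n + 1)), (∑ k, a k * b (σ k)) ^ 2 =
      ∑ i, ∑ j, a i * a j * (n * ∑ σ : Equiv.Perm (Fin (n + 1)), b (σ i) * b (σ j)) := by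
    have hsq (x : Fin (n + 1) → ℝ) : (∑ k, x k) ^ 2 = ∑ i, ∑ j, x i * x j := by
      rw [pow_two, Finset.sum_mul_sum]
    simp only [hsq, Finset.mul_sum]
    rw [Finset.sum_comm]
    refine Finset.sum_congr rfl fun i _ => ?_
    rw [Finset.sum_comm]
    refine Finset.sum_congr rfl fun j _ => Finset.sum_congr rfl fun σ _ => ?_
    ring
  have hcoef (i j : Fin (n + 1)) :
      (if i = j then (n : ℝ) else -1) = (if i = j then (n + 1 : ℝ) else 0) - 1 := by
    split_ifs <;> ring
  have hcross : ∑ i, ∑ j, a i * a j = 0 := by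
    rw [← Finset.sum_mul_sum, ha, zero_mul]
  rw [hexp]
  simp only [sum_perm_mul_eq b hb, hcoef, ← mul_assoc, ← Finset.sum_mul]
  simp only [mul_sub, mul_one, Finset.sum_sub_distrib, hcross, mul_ite, mul_zero,
    Finset.sum_ite_eq, Finset.mem_univ, if_true, ← Finset.sum_mul, Nat.factorial_succ]
  push_cast
  simp only [pow_two]
  ring

/-- Permutations of `n + 1` letters acting on `ℤⁿ`, seen as `ℤⁿ⁺¹` modulo constant vectors. -/
def permAct {n : ℕ} (σ : Equiv.Perm (Fin (n + 1))) (v : Fin n → ℤ) : Fin n → ℤ :=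
  fun i => (Fin.cons 0 v : Fin (n + 1) → ℤ) (σ i.succ) - (Fin.cons 0 v : Fin (n + 1) → ℤ) (σ 0)

theorem cons_permAct {n : ℕ} (σ : Equiv.Perm (Fin (n + 1))) (v : Fin n → ℤ) (k : Fin (n + 1)) :
    (Fin.cons 0 (permAct σ v) : Fin (n + 1) → ℤ) k =
      (Fin.cons 0 v : Fin (n + 1) → ℤ) (σ k) - (Fin.cons 0 v : Fin (n + 1) → ℤ) (σ 0) := by
  refine Fin.cases ?_ (fun i => ?_) k
  · simp
  · simp [permAct]

theorem permAct_permAct_of_mul_eq_one {n : ℕ} {σ τ : Equiv.Perm (Fin (n + 1))} (h : σ * τ = 1)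
    (v : Fin n → ℤ) : permAct τ (permAct σ v) = v := by
  have hk (k) : σ (τ k) = k := by rw [← Equiv.Perm.mul_apply, h, Equiv.Perm.one_apply]
  funext i
  simp only [permAct.eq_1 τ, cons_permAct, hk]
  simp

/-- The action of a permutation on `ℤⁿ` as an equivalence. -/
def permActEquiv {n : ℕ} (σ : Equiv.Perm (Fin (n + 1))) : (Fin n → ℤ) ≃ (Fin n → ℤ) where
  toFun := permAct σ
  invFun := permAct σ⁻¹
  left_inv := permAct_permAct_of_mul_eq_one (mul_inv_cancel σ)
  right_inv := permAct_permAct_of_mul_eq_one (inv_mul_cancel σ)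

/-- The representative of sum zero of the class of `(0, v)` modulo constant vectors. -/
def centered {n : ℕ} (v : Fin n → ℤ) (k : Fin (n + 1)) : ℝ :=
  (Fin.cons 0 v : Fin (n + 1) → ℤ) k - (∑ i, (v i : ℝ)) / (n + 1)

theorem sum_cons_zero {n : ℕ} (v : Fin n → ℤ) :
    ∑ k, (((Fin.cons 0 v : Fin (n + 1) → ℤ) k : ℤ) : ℝ) = ∑ i, (v i : ℝ) := by
  simp [Fin.sum_univ_succ]

theorem sum_centered {n : ℕ} (v : Fin n → ℤ) : ∑ k, centered v k = 0 := by
  simp only [centered, Finset.sum_sub_distrib, sum_cons_zero, Finset.sum_const, Finset.card_univ,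
    Fintype.card_fin, nsmul_eq_mul]
  push_cast
  field_simp
  ring

theorem centered_permAct {n : ℕ} (σ : Equiv.Perm (Fin (n + 1))) (v : Fin n → ℤ)
    (k : Fin (n + 1)) : centered (permAct σ v) k = centered v (σ k) := by
  have hsum : ∑ i, (permAct σ v i : ℝ) =
      (∑ i, (v i : ℝ)) - (n + 1) * (Fin.cons 0 v : Fin (n + 1) → ℤ) (σ 0) := by
    rw [← sum_cons_zero, ← sum_cons_zero v]
    simp only [cons_permAct, Int.cast_sub, Finset.sum_sub_distrib]
    rw [Equiv.sum_comp σ fun k => (((Fin.cons 0 v : Fin (n + 1) → ℤ) k : ℤ) : ℝ)]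
    simp
  simp only [centered, cons_permAct, hsum]
  push_cast
  field_simp
  ring

theorem BF_Ap_eq {n : ℕ} (v w : Fin n → ℤ) :
    BF (Ap (n + 1)) (Zc v) (Zc w) = (n + 1) / 2 * ∑ k, centered v k * centered w k := by
  have hentry (i j : Fin n) :
      Ap (n + 1) i j * Zc v i * Zc w j =
        (if i = j then (n + 1) / 2 * ((v i : ℝ) * w j) else 0) - 1 / 2 * ((v i : ℝ) * w j) := by
    simp only [Ap, Zc]
    split_ifs <;> push_cast <;> ring
  have hleft : BF (Ap (n + 1)) (Zc v) (Zc w) =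
      (n + 1) / 2 * ∑ i, (v i : ℝ) * w i - 1 / 2 * ((∑ i, (v i : ℝ)) * ∑ i, (w i : ℝ)) := by
    change ∑ i : Fin n, ∑ j : Fin n, Ap (n + 1) i j * Zc v i * Zc w j = _
    simp only [hentry, Finset.sum_sub_distrib, Finset.sum_ite_eq, Finset.mem_univ, if_true,
      ← Finset.mul_sum, ← Finset.sum_mul]
  have hright : ∑ k, centered v k * centered w k =
      ∑ i, (v i : ℝ) * w i - (∑ i, (v i : ℝ)) * (∑ i, (w i : ℝ)) / (n + 1) := by
    have hw : ∑ k, centered v k * centered w k =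
        ∑ k, centered v k * (((Fin.cons 0 w : Fin (n + 1) → ℤ) k : ℤ) : ℝ) := by
      simp only [centered.eq_1 w, mul_sub, Finset.sum_sub_distrib, ← Finset.sum_mul, sum_centered,
        zero_mul, sub_zero]
    rw [hw, Fin.sum_univ_succ]
    simp only [centered, Fin.cons_zero, Fin.cons_succ, Int.cast_zero, mul_zero, zero_add, sub_mul,
      Finset.sum_sub_distrib, ← Finset.mul_sum]
    ring
  rw [hleft, hright]
  field_simp

theorem QF_Ap_permAct {n : ℕ} (σ : Equiv.Perm (Fin (n + 1))) (v : Fin n → ℤ) :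
    QF (Ap (n + 1)) (Zc (permAct σ v)) = QF (Ap (n + 1)) (Zc v) := by
  change BF (Ap (n + 1)) (Zc (permAct σ v)) (Zc (permAct σ v)) = BF (Ap (n + 1)) (Zc v) (Zc v)
  rw [BF_Ap_eq, BF_Ap_eq]
  simp only [centered_permAct]
  rw [Equiv.sum_comp σ fun k => centered v k * centered v k]

/-- The permutation orbits are spherical designs of strength two for `A_p`. -/
theorem sum_perm_BF_sq_sub {n : ℕ} (hn : n ≠ 0) (v w : Fin n → ℤ) :
    ∑ σ : Equiv.Perm (Fin (n + 1)),
      ((BF (Ap (n + 1)) (Zc v) (Zc (permAct σ w))) ^ 2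
        - 1 / (((n + 1 : ℕ) : ℝ) - 1) * QF (Ap (n + 1)) (Zc v) * QF (Ap (n + 1)) (Zc w)) = 0 := by
  have hn' : (n : ℝ) ≠ 0 := Nat.cast_ne_zero.mpr hn
  have hQ (u : Fin n → ℤ) :
      QF (Ap (n + 1)) (Zc u) = (n + 1) / 2 * ∑ k, centered u k ^ 2 := by
    simp only [pow_two]
    exact BF_Ap_eq u u
  have hmoment := sum_perm_inner_sq _ _ (sum_centered v) (sum_centered w)
  simp only [BF_Ap_eq, hQ, centered_permAct, mul_pow, Finset.sum_sub_distrib, ← Finset.mul_sum,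
    Finset.sum_const, Finset.card_univ, Fintype.card_perm, Fintype.card_fin, nsmul_eq_mul]
  rw [eq_div_of_mul_eq hn' ((mul_comm _ _).trans hmoment)]
  push_cast
  rw [add_sub_cancel_right]
  ring

/-- A series whose terms average to zero along a finite family of permutations of the index set
has sum zero. -/
theorem tsum_eq_zero_of_sum_comp_eq_zero {ι α : Type*} [Fintype ι] [Nonempty ι]
    (e : ι → α ≃ α) (f : α → ℂ) (h : ∀ x, ∑ i, f (e i x) = 0) : ∑' x, f x = 0 := by
  by_cases hf : Summable f
  · have hsum : ∑ i, ∑' x, f (e i x) = 0 := by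
      have hfe (i : ι) : Summable fun x => f (e i x) := (e i).summable_iff.mpr hf
      rw [← Summable.tsum_finsetSum fun i _ => hfe i]
      simp [h]
    simpa [Equiv.tsum_eq] using hsum
  · exact tsum_eq_zero_of_not_summable hf

/-- For an odd prime `p` and `A = A_p = (1/2)(p·Id − J)` of rank `n = p - 1`, the series
`Θ_{1,1;A}` vanishes identically on the upper half plane. -/
theorem theta11_Ap_eq_zero (p : ℕ) (hp : p.Prime) (hodd : Odd p) :
    ∀ τ : ℂ, 0 < τ.im →
      ∑' pr : (Fin (p - 1) → ℤ) × (Fin (p - 1) → ℤ),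
        (((BF (Ap p) (Zc pr.1) (Zc pr.2)) ^ 2
            - (1 / ((p : ℝ) - 1)) * QF (Ap p) (Zc pr.1) * QF (Ap p) (Zc pr.2) : ℝ) : ℂ) *
          eq2 (QF (Ap p) (Zc pr.1) + QF (Ap p) (Zc pr.2)) τ = 0 := by
  obtain ⟨n, rfl⟩ := Nat.exists_eq_succ_of_ne_zero hp.ne_zero
  intro τ _
  have hn : n ≠ 0 := by
    rintro rfl
    exact Nat.not_prime_one hp
  refine tsum_eq_zero_of_sum_comp_eq_zero
    (fun σ : Equiv.Perm (Fin (n + 1)) => (Equiv.refl (Fin n → ℤ)).prodCongr (permActEquiv σ))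
    _ fun x => ?_
  obtain ⟨v, w⟩ := x
  have hQ (σ : Equiv.Perm (Fin (n + 1))) := QF_Ap_permAct σ w
  have hzero := sum_perm_BF_sq_sub hn v w
  change ∑ σ : Equiv.Perm (Fin (n + 1)),
    (((BF (Ap (n + 1)) (Zc v) (Zc (permAct σ w))) ^ 2
      - 1 / (((n + 1 : ℕ) : ℝ) - 1) * QF (Ap (n + 1)) (Zc v)
        * QF (Ap (n + 1)) (Zc (permAct σ w)) : ℝ) : ℂ) *
      eq2 (QF (Ap (n + 1)) (Zc v) + QF (Ap (n + 1)) (Zc (permAct σ w))) τ = 0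
  simp only [hQ]
  rw [← Finset.sum_mul, ← Complex.ofReal_sum, hzero, Complex.ofReal_zero, zero_mul]
end
end

section
/- Let Λ ⊂ ℝⁿ be a lattice (the ℤ-span of an ℝ-basis of ℝⁿ) and let O_Λ = {φ ∈ O(n) : φ(Λ) = Λ} be its orthogonal group. If the action of O_Λ on ℝⁿ is irreducible (the only O_Λ-invariant linear subspaces of ℝⁿ are 0 and ℝⁿ), then the series Θ_{1,1;Λ} vanishes identically on the upper half plane. -/
open scoped BigOperators

noncomputable section

/-- The standard Euclidean inner product on `ℝⁿ`. -/
def ip {n : ℕ} (v w : Fin n → ℝ) : ℝ := ∑ i, v i * w i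

/-- The squared Euclidean norm on `ℝⁿ`. -/
def nsq {n : ℕ} (v : Fin n → ℝ) : ℝ := ∑ i, v i ^ 2

/-- The lattice vector `Σᵢ cᵢ bᵢ` attached to the integer coefficient vector `c`. -/
def LV {n : ℕ} (b : Fin n → Fin n → ℝ) (c : Fin n → ℤ) : Fin n → ℝ :=
  ∑ i, (c i : ℝ) • b i

open Matrix

lemma nsq_eq_dotProduct_self {n : ℕ} (x : Fin n → ℝ) : nsq x = x ⬝ᵥ x := by
  simp [nsq, dotProduct, pow_two]

lemma nsq_mulVec_of_mem_orthogonalGroup {n : ℕ} {M : Matrix (Fin n) (Fin n) ℝ}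
    (hM : M ∈ Matrix.orthogonalGroup (Fin n) ℝ) (x : Fin n → ℝ) :
    nsq (M *ᵥ x) = nsq x := by
  have h : Mᵀ * M = 1 := (Matrix.mem_orthogonalGroup_iff' (Fin n) ℝ).1 hM
  rw [nsq_eq_dotProduct_self, nsq_eq_dotProduct_self, Matrix.dotProduct_mulVec, Matrix.vecMul_mulVec, h,
    Matrix.vecMul_one]

lemma norm_sq_le_nsq {n : ℕ} (x : Fin n → ℝ) : ‖x‖ ^ 2 ≤ nsq x := by
  have h0 : 0 ≤ nsq x := Finset.sum_nonneg fun i _ => sq_nonneg _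
  have h : ‖x‖ ≤ √(nsq x) := by
    refine (pi_norm_le_iff_of_nonneg (Real.sqrt_nonneg _)).2 fun i => ?_
    refine Real.le_sqrt_of_sq_le ?_
    rw [Real.norm_eq_abs, sq_abs]
    exact Finset.single_le_sum (f := fun i => x i ^ 2) (fun i _ => sq_nonneg _)
      (Finset.mem_univ i)
  calc ‖x‖ ^ 2 ≤ √(nsq x) ^ 2 := by gcongr
    _ = nsq x := Real.sq_sqrt h0

lemma sq_mul_exp_neg_le {a : ℝ} (ha : 0 < a) (k : ℕ) (hk : k ≠ 0) {r : ℝ} (hr : 0 ≤ r) :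
    r ^ 2 * Real.exp (-(a * r ^ 2)) ≤
      ((k + 1).factorial / a ^ (k + 1)) * r⁻¹ ^ (2 * k) := by
  rcases hr.eq_or_lt with rfl | hr
  · simp [hk]
  have h := Real.pow_div_factorial_le_exp (x := a * r ^ 2) (by positivity) (k + 1)
  rw [Real.exp_neg, ← div_eq_mul_inv, div_le_iff₀ (Real.exp_pos _)]
  refine le_trans (le_of_eq ?_) (mul_le_mul_of_nonneg_left h (by positivity))
  rw [mul_pow, ← pow_mul, mul_add 2 k 1, pow_add r, inv_pow]
  field_simp

lemma LV_injective {n : ℕ} {b : Fin n → Fin n → ℝ} (hb : LinearIndependent ℝ b) :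
    Function.Injective (LV b) := by
  intro c d h
  have h' := Fintype.linearIndependent_iff.1 hb (fun i => (c i : ℝ) - d i) (by
    simpa [sub_smul, Finset.sum_sub_distrib, sub_eq_zero, LV] using h)
  ext i
  exact_mod_cast sub_eq_zero.1 (h' i)

lemma summable_LV_mul_weight {n : ℕ} {b : Fin n → Fin n → ℝ} (hb : LinearIndependent ℝ b)
    (hspan : Submodule.span ℝ (Set.range b) = ⊤) {a : ℝ} (ha : 0 < a)
    {𝕜 : Type*} [RCLike 𝕜] {w : (Fin n → ℝ) → 𝕜}
    (hw : ∀ x, ‖w x‖ ≤ Real.exp (-(a * nsq x))) (i j : Fin n) :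
    Summable fun c : Fin n → ℤ => ‖((LV b c i * LV b c j : ℝ) : 𝕜) * w (LV b c)‖ := by
  let B := Module.Basis.mk hb hspan.ge
  have hmem (c : Fin n → ℤ) : LV b c ∈ Submodule.span ℤ (Set.range B) := by
    refine Submodule.sum_mem _ fun i _ => ?_
    rw [Int.cast_smul_eq_zsmul]
    exact Submodule.smul_mem _ _ (Submodule.subset_span ⟨i, by simp [B]⟩)
  let L := Submodule.span ℤ (Set.range B)
  set k := Module.finrank ℤ L + 1 with hk
  have hsum := ((ZLattice.summable_norm_pow_inv (L := L) (2 * k) (by omega)).mul_left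
    (((k + 1).factorial : ℝ) / a ^ (k + 1))).comp_injective
    (i := fun c => (⟨LV b c, hmem c⟩ : L))
    (fun c d h => LV_injective hb (congrArg Subtype.val h))
  refine Summable.of_nonneg_of_le (fun _ => norm_nonneg _) (fun c => ?_) hsum
  refine le_trans ?_ (sq_mul_exp_neg_le ha k (by omega) (norm_nonneg (LV b c)))
  rw [norm_mul, RCLike.norm_ofReal, abs_mul, pow_two]
  refine mul_le_mul ?_ ((hw _).trans ?_) (norm_nonneg _) (by positivity)
  · exact mul_le_mul (norm_le_pi_norm (LV b c) i) (norm_le_pi_norm (LV b c) j) (abs_nonneg _)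
      (norm_nonneg _)
  · refine Real.exp_le_exp.2 (neg_le_neg (mul_le_mul_of_nonneg_left ?_ ha.le))
    rw [← pow_two]; exact norm_sq_le_nsq _

/-- A symmetric matrix commuting with an irreducible set of matrices is scalar. -/
lemma exists_eq_smul_one_of_commute {n : ℕ} (hn : 0 < n)
    {P : Matrix (Fin n) (Fin n) ℝ → Prop}
    (hirr : ∀ W : Submodule ℝ (Fin n → ℝ), (∀ M, P M → ∀ x ∈ W, M *ᵥ x ∈ W) → W = ⊥ ∨ W = ⊤)
    {A : Matrix (Fin n) (Fin n) ℝ} (hA : A.IsHermitian) (hcomm : ∀ M, P M → Commute M A) :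
    ∃ s : ℝ, A = s • (1 : Matrix (Fin n) (Fin n) ℝ) := by
  let i₀ : Fin n := ⟨0, hn⟩
  set s := hA.eigenvalues i₀
  refine ⟨s, ?_⟩
  let W : Submodule ℝ (Fin n → ℝ) := LinearMap.ker (A - s • 1).mulVecLin
  have hW (x) : x ∈ W ↔ A *ᵥ x = s • x := by
    simp [W, sub_eq_zero]
  rcases hirr W (fun M hM x hx => by
    rw [hW] at hx ⊢
    rw [Matrix.mulVec_mulVec, ← (hcomm M hM).eq, ← Matrix.mulVec_mulVec, hx,
      Matrix.mulVec_smul]) with h | h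
  · exfalso
    have hmem : (hA.eigenvectorBasis i₀).ofLp ∈ W := (hW _).2 (hA.mulVec_eigenvectorBasis i₀)
    rw [h, Submodule.mem_bot] at hmem
    exact hA.eigenvectorBasis.orthonormal.ne_zero i₀ (WithLp.ofLp_injective 2 hmem)
  · refine Matrix.toLin'.injective (LinearMap.ext fun x => ?_)
    have hx : A *ᵥ x = s • x := (hW x).1 (h ▸ Submodule.mem_top)
    rw [Matrix.toLin'_apply, Matrix.toLin'_apply, hx, Matrix.smul_mulVec, Matrix.one_mulVec]

/-- The weighted second moment matrix `∑_{x ∈ Λ} w(x) x xᵀ` of the lattice spanned by `b`. -/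
def momentMatrix {n : ℕ} (b : Fin n → Fin n → ℝ) (w : (Fin n → ℝ) → ℝ) :
    Matrix (Fin n) (Fin n) ℝ :=
  Matrix.of fun i j => ∑' c : Fin n → ℤ, LV b c i * LV b c j * w (LV b c)

lemma isHermitian_momentMatrix {n : ℕ} (b : Fin n → Fin n → ℝ) (w : (Fin n → ℝ) → ℝ) :
    (momentMatrix b w).IsHermitian := by
  ext i j
  simp [momentMatrix, mul_comm (LV b _ j)]

lemma exists_perm_LV_eq_mulVec {n : ℕ} {b : Fin n → Fin n → ℝ} (hb : LinearIndependent ℝ b)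
    {M : Matrix (Fin n) (Fin n) ℝ} (hM : M ∈ Matrix.orthogonalGroup (Fin n) ℝ)
    (hMΛ : M.mulVec '' Set.range (LV b) = Set.range (LV b)) :
    ∃ σ : Equiv.Perm (Fin n → ℤ), ∀ c, LV b (σ c) = M *ᵥ LV b c := by
  have h : Mᵀ * M = 1 := (Matrix.mem_orthogonalGroup_iff' (Fin n) ℝ).1 hM
  have hex (c : Fin n → ℤ) : ∃ d, LV b d = M *ᵥ LV b c := by
    have : M *ᵥ LV b c ∈ Set.range (LV b) := hMΛ ▸ ⟨_, ⟨c, rfl⟩, rfl⟩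
    exact this
  choose f hf using hex
  refine ⟨Equiv.ofBijective f ⟨fun c d hcd => ?_, fun d => ?_⟩, hf⟩
  · have h1 : M *ᵥ LV b c = M *ᵥ LV b d := by rw [← hf, ← hf, hcd]
    have h2 := congrArg (Mᵀ *ᵥ ·) h1
    simp only [Matrix.mulVec_mulVec, h, Matrix.one_mulVec] at h2
    exact LV_injective hb h2
  · have : LV b d ∈ M.mulVec '' Set.range (LV b) := hMΛ.symm ▸ ⟨d, rfl⟩
    obtain ⟨_, ⟨c, rfl⟩, hc⟩ := this
    exact ⟨c, LV_injective hb ((hf c).trans hc)⟩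

lemma commute_momentMatrix {n : ℕ} {b : Fin n → Fin n → ℝ} (hb : LinearIndependent ℝ b)
    {w : (Fin n → ℝ) → ℝ}
    (hsum : ∀ i j, Summable fun c : Fin n → ℤ => LV b c i * LV b c j * w (LV b c))
    {M : Matrix (Fin n) (Fin n) ℝ} (hM : M ∈ Matrix.orthogonalGroup (Fin n) ℝ)
    (hMΛ : M.mulVec '' Set.range (LV b) = Set.range (LV b)) (hw : ∀ x, w (M *ᵥ x) = w x) :
    Commute M (momentMatrix b w) := by
  have h : Mᵀ * M = 1 := (Matrix.mem_orthogonalGroup_iff' (Fin n) ℝ).1 hM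
  obtain ⟨σ, hσ⟩ := exists_perm_LV_eq_mulVec hb hM hMΛ
  ext i j
  have hl : (M * momentMatrix b w) i j =
      ∑' c : Fin n → ℤ, (M *ᵥ LV b c) i * LV b c j * w (LV b c) := by
    simp only [Matrix.mul_apply, momentMatrix, Matrix.of_apply, ← tsum_mul_left]
    rw [← Summable.tsum_finsetSum fun k _ => (hsum k j).mul_left _]
    simp [Matrix.mulVec, dotProduct, Finset.sum_mul, mul_assoc]
  have hr : (momentMatrix b w * M) i j =
      ∑' c : Fin n → ℤ, LV b c i * (Mᵀ *ᵥ LV b c) j * w (LV b c) := by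
    simp only [Matrix.mul_apply, momentMatrix, Matrix.of_apply, ← tsum_mul_right]
    rw [← Summable.tsum_finsetSum fun k _ => (hsum i k).mul_right _]
    refine tsum_congr fun c => ?_
    simp only [Matrix.mulVec, dotProduct, Finset.sum_mul, Finset.mul_sum, Matrix.transpose_apply]
    exact Finset.sum_congr rfl fun k _ => by ring
  rw [hl, hr, ← σ.tsum_eq fun c => LV b c i * (Mᵀ *ᵥ LV b c) j * w (LV b c)]
  refine tsum_congr fun c => ?_
  rw [hσ, hw, Matrix.mulVec_mulVec, h, Matrix.one_mulVec]

lemma ip_sq_sub_eq_sum {n : ℕ} (a : ℝ) (x y : Fin n → ℝ) :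
    ip x y ^ 2 - a * nsq x * nsq y =
      ∑ i, ∑ j, ((x i * x j) * (y i * y j) - a * ((x i * x i) * (y j * y j))) := by
  rw [ip, nsq, nsq, pow_two, Finset.sum_mul_sum, mul_assoc, Finset.sum_mul_sum, Finset.mul_sum,
    ← Finset.sum_sub_distrib]
  refine Finset.sum_congr rfl fun i _ => ?_
  rw [Finset.mul_sum, ← Finset.sum_sub_distrib]
  exact Finset.sum_congr rfl fun j _ => by ring

lemma sum_sq_sub_eq_zero_of_eq_ite {n : ℕ} (hn : 0 < n) {S : Fin n → Fin n → ℂ} {s : ℂ}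
    (hS : ∀ i j, S i j = if i = j then s else 0) :
    ∑ i, ∑ j, (S i j * S i j - (1 / (n : ℂ)) * (S i i * S j j)) = 0 := by
  have : (n : ℂ) ≠ 0 := by exact_mod_cast hn.ne'
  simp [hS, Finset.sum_sub_distrib]
  field_simp
  simp

/-- Let `Λ ⊂ ℝⁿ` be a lattice (the ℤ-span of an ℝ-basis `b` of `ℝⁿ`) whose orthogonal
group `O_Λ = {φ ∈ O(n) : φ(Λ) = Λ}` acts irreducibly on `ℝⁿ`.  Then `Θ_{1,1;Λ}`
vanishes identically on the upper half plane. -/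
theorem theta11_eq_zero_of_irreducible_orthogonal_group
    (n : ℕ) (hn : 0 < n) (b : Fin n → Fin n → ℝ)
    (hb : LinearIndependent ℝ b) (hspan : Submodule.span ℝ (Set.range b) = ⊤)
    (Λ : Set (Fin n → ℝ)) (hΛ : Λ = {x | ∃ c : Fin n → ℤ, x = LV b c})
    (hirr : ∀ W : Submodule ℝ (Fin n → ℝ),
      (∀ M : Matrix (Fin n) (Fin n) ℝ, M ∈ Matrix.orthogonalGroup (Fin n) ℝ →
        M.mulVec '' Λ = Λ → ∀ x ∈ W, M.mulVec x ∈ W) →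
      W = ⊥ ∨ W = ⊤) :
    ∀ τ : ℂ, 0 < τ.im →
      ∑' cd : (Fin n → ℤ) × (Fin n → ℤ),
        (((ip (LV b cd.1) (LV b cd.2)) ^ 2
            - (1 / (n : ℝ)) * nsq (LV b cd.1) * nsq (LV b cd.2) : ℝ) : ℂ) *
          eq2 (nsq (LV b cd.1) + nsq (LV b cd.2)) τ = 0 := by
  intro τ hτ
  have hΛ' : Λ = Set.range (LV b) := by
    rw [hΛ]; ext x; simp [eq_comm]
  subst hΛ'
  let e : (Fin n → ℝ) → ℂ := fun x => eq2 (nsq x) τ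
  have ha : 0 < 2 * Real.pi * τ.im := by positivity
  have he (x) : ‖e x‖ ≤ Real.exp (-(2 * Real.pi * τ.im * nsq x)) := (norm_eq2 _ _).le
  have hscalar (w : (Fin n → ℝ) → ℝ) (hwb : ∀ x, |w x| ≤ ‖e x‖)
      (hwr : ∀ x y, nsq x = nsq y → w x = w y) :
      ∃ s : ℝ, ∀ i j, HasSum (fun c => LV b c i * LV b c j * w (LV b c))
        (if i = j then s else 0) := by
    have hsum (i j) : Summable fun c : Fin n → ℤ => LV b c i * LV b c j * w (LV b c) :=
      (summable_LV_mul_weight hb hspan ha (𝕜 := ℝ) (fun x => (hwb x).trans (he x)) i j).of_norm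
    obtain ⟨s, hs⟩ := exists_eq_smul_one_of_commute hn
      (P := fun M => M ∈ Matrix.orthogonalGroup (Fin n) ℝ ∧
        M.mulVec '' Set.range (LV b) = Set.range (LV b))
      (fun W hW => hirr W fun M h1 h2 => hW M ⟨h1, h2⟩)
      (isHermitian_momentMatrix b w)
      (fun M hM => commute_momentMatrix hb hsum hM.1 hM.2 fun x =>
        hwr _ _ (nsq_mulVec_of_mem_orthogonalGroup hM.1 x))
    refine ⟨s, fun i j => ?_⟩
    have hij := congrFun (congrFun hs i) j
    rw [Matrix.smul_apply, Matrix.one_apply, smul_eq_mul, mul_ite, mul_one, mul_zero] at hij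
    rw [← hij]
    exact (hsum i j).hasSum
  obtain ⟨s₁, h₁⟩ := hscalar (fun x => (e x).re) (fun x => Complex.abs_re_le_norm _)
    (fun x y h => by simp only [e, h])
  obtain ⟨s₂, h₂⟩ := hscalar (fun x => (e x).im) (fun x => Complex.abs_im_le_norm _)
    (fun x y h => by simp only [e, h])
  let S : Fin n → Fin n → ℂ := fun i j => if i = j then (⟨s₁, s₂⟩ : ℂ) else 0
  let g : Fin n → Fin n → (Fin n → ℤ) → ℂ := fun i j c =>
    ((LV b c i * LV b c j : ℝ) : ℂ) * e (LV b c)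
  have hg (i j) : HasSum (g i j) (S i j) := by
    refine Complex.hasSum_iff _ _ |>.2 ⟨?_, ?_⟩
    · convert h₁ i j using 1
      · ext c; simp only [g, Complex.re_ofReal_mul]
      · simp only [S]; split_ifs <;> rfl
    · convert h₂ i j using 1
      · ext c; simp only [g, Complex.im_ofReal_mul]
      · simp only [S]; split_ifs <;> rfl
  have hgn (i j) : Summable fun c => ‖g i j c‖ :=
    summable_LV_mul_weight hb hspan ha (𝕜 := ℂ) he i j
  have hprod (i j k l) : HasSum
      (fun cd : (Fin n → ℤ) × (Fin n → ℤ) => g i j cd.1 * g k l cd.2) (S i j * S k l) :=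
    (hg i j).mul (hg k l) (summable_mul_of_summable_norm (hgn i j) (hgn k l))
  have hfin := hasSum_sum (s := Finset.univ) fun i _ => hasSum_sum (s := Finset.univ) fun j _ =>
    (hprod i j i j).sub ((hprod i i j j).mul_left (1 / (n : ℂ)))
  rw [sum_sq_sub_eq_zero_of_eq_ite hn (s := ⟨s₁, s₂⟩) fun i j => rfl] at hfin
  rw [← hfin.tsum_eq]
  refine tsum_congr fun cd => ?_
  rw [ip_sq_sub_eq_sum, eq2_add]
  simp only [Complex.ofReal_sum, Finset.sum_mul]
  refine Finset.sum_congr rfl fun i _ => Finset.sum_congr rfl fun j _ => ?_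
  simp only [g, e]
  push_cast
  ring
end
end

section
/- Let G be a finite subgroup of the orthogonal group O(n) acting irreducibly on ℝⁿ (the only G-invariant linear subspaces of ℝⁿ are 0 and ℝⁿ). Then for all x, y ∈ ℝⁿ: Σ_{g∈G} ⟨g(x), y⟩² = (|G|/n)·‖x‖²·‖y‖². -/
open scoped BigOperators

noncomputable section

open Matrix in
/-- A real symmetric matrix which commutes with an irreducible set of matrices is scalar. -/
lemma exists_mulVec_eq_smul_of_irreducible {n : ℕ} (hn : 0 < n)
    (A : Set (Matrix (Fin n) (Fin n) ℝ))
    (hirr : ∀ W : Submodule ℝ (Fin n → ℝ), (∀ M ∈ A, ∀ x ∈ W, M *ᵥ x ∈ W) → W = ⊥ ∨ W = ⊤)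
    (S : Matrix (Fin n) (Fin n) ℝ) (hS : S.IsHermitian) (hcomm : ∀ M ∈ A, Commute S M) :
    ∃ c : ℝ, ∀ v, S *ᵥ v = c • v := by
  let i : Fin n := ⟨0, hn⟩
  refine ⟨hS.eigenvalues i, fun v => ?_⟩
  have hv := hS.mulVec_eigenvectorBasis i
  have hne : (hS.eigenvectorBasis i).ofLp ≠ 0 := fun h =>
    hS.eigenvectorBasis.orthonormal.ne_zero i (WithLp.ofLp_injective 2 h)
  generalize hS.eigenvalues i = c at *
  have hmem : ∀ w, w ∈ LinearMap.ker (S.mulVecLin - c • LinearMap.id) ↔ S *ᵥ w = c • w := by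
    intro w
    simp [sub_eq_zero]
  rcases hirr (LinearMap.ker (S.mulVecLin - c • LinearMap.id)) (fun M hM w hw => by
    rw [hmem] at hw ⊢
    rw [mulVec_mulVec, (hcomm M hM).eq, ← mulVec_mulVec, hw, mulVec_smul]) with h | h
  · have := (hmem _).2 hv
    rw [h, Submodule.mem_bot] at this
    exact absurd this hne
  · exact (hmem v).1 (h ▸ Submodule.mem_top)

/-- The squared norm is the dot product of a vector with itself. -/
lemma nsq_eq_dotProduct {n : ℕ} (v : Fin n → ℝ) : nsq v = v ⬝ᵥ v := by
  simp [nsq, dotProduct, sq]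

open Matrix in
/-- Orthogonal matrices preserve the dot product. -/
lemma dotProduct_mulVec_mulVec_of_mem_orthogonalGroup {n : ℕ}
    (g : Matrix.orthogonalGroup (Fin n) ℝ) (v w : Fin n → ℝ) :
    ((g : Matrix (Fin n) (Fin n) ℝ) *ᵥ v) ⬝ᵥ ((g : Matrix (Fin n) (Fin n) ℝ) *ᵥ w) = v ⬝ᵥ w := by
  have h : (g : Matrix (Fin n) (Fin n) ℝ)ᵀ * (g : Matrix (Fin n) (Fin n) ℝ) = 1 :=
    (Matrix.mem_orthogonalGroup_iff' (Fin n) ℝ).1 g.2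
  rw [dotProduct_mulVec, ← mulVec_transpose, mulVec_mulVec, h, one_mulVec]

/-- Let `G` be a finite subgroup of the orthogonal group `O(n)` acting irreducibly on
`ℝⁿ`.  Then for all `x, y ∈ ℝⁿ`: `Σ_{g ∈ G} ⟨g(x), y⟩² = (|G|/n) ‖x‖² ‖y‖²`. -/
theorem sum_sq_inner_orbit_of_irreducible
    (n : ℕ) (hn : 0 < n)
    (G : Subgroup (Matrix.orthogonalGroup (Fin n) ℝ)) [Fintype G]
    (hirr : ∀ W : Submodule ℝ (Fin n → ℝ),
      (∀ g : G, ∀ x ∈ W,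
        Matrix.mulVec ((g : Matrix.orthogonalGroup (Fin n) ℝ) : Matrix (Fin n) (Fin n) ℝ) x ∈ W) →
      W = ⊥ ∨ W = ⊤)
    (x y : Fin n → ℝ) :
    ∑ g : G,
        (ip (Matrix.mulVec ((g : Matrix.orthogonalGroup (Fin n) ℝ) : Matrix (Fin n) (Fin n) ℝ) x) y) ^ 2
      = ((Fintype.card G : ℝ) / n) * nsq x * nsq y := by
  let u : G → Fin n → ℝ := fun g =>
    Matrix.mulVec ((g : Matrix.orthogonalGroup (Fin n) ℝ) : Matrix (Fin n) (Fin n) ℝ) x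
  let S : Matrix (Fin n) (Fin n) ℝ := ∑ g : G, Matrix.vecMulVec (u g) (u g)
  have hSv : ∀ v, S.mulVec v = ∑ g : G, (u g ⬝ᵥ v) • u g := by
    intro v
    simp only [S, Matrix.sum_mulVec, Matrix.vecMulVec_mulVec, op_smul_eq_smul]
  have hS : S.IsHermitian := by
    simp [S, Matrix.IsHermitian, Matrix.transpose_sum, Matrix.transpose_vecMulVec]
  have hcomm : ∀ h : G, Commute S
      ((h : Matrix.orthogonalGroup (Fin n) ℝ) : Matrix (Fin n) (Fin n) ℝ) := by
    intro h
    refine Matrix.mulVec_injective (funext fun v => ?_)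
    have hu : ∀ g : G, u (h * g) =
        ((h : Matrix.orthogonalGroup (Fin n) ℝ) : Matrix (Fin n) (Fin n) ℝ).mulVec (u g) := by
      intro g
      simp [u, Matrix.mulVec_mulVec]
    rw [← Matrix.mulVec_mulVec, ← Matrix.mulVec_mulVec, hSv, hSv, Matrix.mulVec_sum,
      ← Equiv.sum_comp (Equiv.mulLeft h)]
    refine Finset.sum_congr rfl fun g _ => ?_
    rw [Equiv.coe_mulLeft, hu, dotProduct_mulVec_mulVec_of_mem_orthogonalGroup,
      Matrix.mulVec_smul]
  obtain ⟨c, hc⟩ := exists_mulVec_eq_smul_of_irreducible hn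
    (Set.range fun g : G => ((g : Matrix.orthogonalGroup (Fin n) ℝ) : Matrix (Fin n) (Fin n) ℝ))
    (fun W hW => hirr W fun g => hW _ ⟨g, rfl⟩) S hS (by rintro _ ⟨h, rfl⟩; exact hcomm h)
  have hSc : S = c • (1 : Matrix (Fin n) (Fin n) ℝ) :=
    Matrix.mulVec_injective (funext fun v => by simp [hc, Matrix.smul_mulVec])
  have htr : (Fintype.card G : ℝ) * nsq x = c * n := by
    have h : S.trace = c * n := by simp [hSc]
    rw [← h]
    simp [S, Matrix.trace_sum, Matrix.trace_vecMulVec, u,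
      dotProduct_mulVec_mulVec_of_mem_orthogonalGroup, nsq_eq_dotProduct]
  have hy : ∑ g : G, (ip (u g) y) ^ 2 = c * nsq y := by
    have h := congrArg (· ⬝ᵥ y) ((hSv y).symm.trans (hc y))
    simp only [sum_dotProduct, smul_dotProduct, smul_eq_mul, ← sq, ← nsq_eq_dotProduct] at h
    exact h
  have hn' : (n : ℝ) ≠ 0 := by exact_mod_cast hn.ne'
  refine hy.trans ?_
  rw [div_mul_eq_mul_div, htr, mul_div_cancel_right₀ _ hn']
end
end

section
/- Let A = (a_{ij}) be a positive definite real symmetric n×n matrix such that the n(n+1)/2 real numbers {a_{ij}}_{1 ≤ i ≤ j ≤ n} are linearly independent over ℚ. Then for all m, m′ ∈ ℤⁿ, the equality ᵗmAm = ᵗm′Am′ implies m′ = m or m′ = −m. -/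
open scoped BigOperators

noncomputable section

theorem sum_sum_eq_sum_le_of_symm {ι R : Type*} [Fintype ι] [LinearOrder ι] [CommSemiring R]
    (f : ι → ι → R) (hf : ∀ i j, f i j = f j i) :
    ∑ i, ∑ j, f i j =
      ∑ p : {p : ι × ι // p.1 ≤ p.2}, (if p.1.1 = p.1.2 then 1 else 2) * f p.1.1 p.1.2 := by
  have hsub : ∑ p : {p : ι × ι // p.1 ≤ p.2}, (if p.1.1 = p.1.2 then 1 else 2) * f p.1.1 p.1.2 =
      ∑ i, ∑ j, if i ≤ j then (if i = j then 1 else 2) * f i j else 0 := by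
    rw [← Fintype.sum_prod_type' (fun i j => if i ≤ j then (if i = j then 1 else 2) * f i j else 0),
      ← Finset.sum_filter]
    exact (Finset.sum_subtype (Finset.univ.filter fun p : ι × ι => p.1 ≤ p.2) (by simp)
      (fun p : ι × ι => (if p.1 = p.2 then 1 else 2) * f p.1 p.2)).symm
  have hsplit : ∑ i, ∑ j, f i j =
      ∑ i, ∑ j, (if i ≤ j then f i j else 0) + ∑ i, ∑ j, (if j < i then f i j else 0) := by
    simp only [← Finset.sum_add_distrib]
    refine Finset.sum_congr rfl fun i _ => Finset.sum_congr rfl fun j _ => ?_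
    rcases le_or_gt i j with hij | hij
    · simp [hij, hij.not_gt]
    · simp [hij, hij.not_ge]
  rw [hsub, hsplit, Finset.sum_comm (f := fun i j => if j < i then f i j else 0)]
  simp only [← Finset.sum_add_distrib]
  refine Finset.sum_congr rfl fun i _ => Finset.sum_congr rfl fun j _ => ?_
  rw [hf j i]
  rcases lt_trichotomy i j with hij | rfl | hij
  · simp [hij, hij.le, hij.ne, two_mul]
  · simp
  · simp [hij.not_ge, hij.not_gt]

theorem eq_or_eq_neg_of_mul_eq_mul {ι R : Type*} [CommRing R] [IsDomain R] {u v : ι → R}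
    (h : ∀ i j, u i * u j = v i * v j) : v = u ∨ v = -u := by
  by_cases hu : ∃ i, u i ≠ 0
  · obtain ⟨i, hi⟩ := hu
    rcases mul_self_eq_mul_self_iff.mp (h i i) with hv | hv
    · left
      funext j
      have := h i j
      rw [← hv] at this
      exact (mul_left_cancel₀ hi this).symm
    · right
      funext j
      refine mul_left_cancel₀ hi ?_
      have := h i j
      rw [Pi.neg_apply, mul_neg, this, hv, neg_mul]
  · push Not at hu
    left
    funext i
    have := h i i
    rw [hu i, zero_mul] at this
    rw [hu i, mul_self_eq_zero.mp this.symm]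

/-- Let `A = (a_{ij})` be a positive definite real symmetric `n×n` matrix whose entries
`{a_{ij}}_{i ≤ j}` are linearly independent over `ℚ`.  Then for all `m, m' ∈ ℤⁿ`,
`ᵗmAm = ᵗm'Am'` implies `m' = m` or `m' = -m`. -/
theorem eq_or_neg_of_eq_values_of_rational_independent
    (n : ℕ) (A : Matrix (Fin n) (Fin n) ℝ)
    (hAsym : A.IsSymm) (hApos : A.PosDef)
    (hli : LinearIndependent ℚ
      (fun p : {p : Fin n × Fin n // p.1 ≤ p.2} => A p.1.1 p.1.2))
    (m m' : Fin n → ℤ) (h : QF A (Zc m) = QF A (Zc m')) :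
    m' = m ∨ m' = -m := by
  refine eq_or_eq_neg_of_mul_eq_mul ?_
  set d : Fin n → Fin n → ℤ := fun i j => m i * m j - m' i * m' j with hd
  have hsum : ∑ i, ∑ j, (d i j : ℝ) * A i j = 0 := by
    rw [← sub_eq_zero.mpr h]
    simp only [QF, Zc, hd, ← Finset.sum_sub_distrib]
    refine Finset.sum_congr rfl fun i _ => Finset.sum_congr rfl fun j _ => ?_
    push_cast
    ring
  have hsymm : ∀ i j, (d i j : ℝ) * A i j = (d j i : ℝ) * A j i := by
    intro i j
    rw [hAsym.apply j i]
    simp only [hd, mul_comm]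
  rw [sum_sum_eq_sum_le_of_symm (fun i j => (d i j : ℝ) * A i j) hsymm] at hsum
  have hcoeff := Fintype.linearIndependent_iff.mp hli
    (fun p => (if p.1.1 = p.1.2 then 1 else 2) * (d p.1.1 p.1.2 : ℚ)) (by
      rw [← hsum]
      refine Finset.sum_congr rfl fun p _ => ?_
      rw [Rat.smul_def]
      push_cast
      split_ifs <;> simp [mul_assoc])
  have hle : ∀ i j, i ≤ j → m i * m j = m' i * m' j := by
    intro i j hij
    have hz := (mul_eq_zero.mp (hcoeff ⟨(i, j), hij⟩)).resolve_left (by split_ifs <;> norm_num)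
    exact sub_eq_zero.mp (by exact_mod_cast hz)
  intro i j
  rcases le_total i j with hij | hij
  · exact hle i j hij
  · rw [mul_comm (m i), mul_comm (m' i), hle j i hij]
end
end

section
/- Global Torelli in rank two: let A and A′ be positive definite real symmetric 2×2 matrices with equal theta series, i.e. Θ_A(τ) = Θ_{A′}(τ) for all τ in the upper half plane. Then A and A′ are equivalent: there exists T ∈ GL₂(ℤ) with A′ = ᵗT A T. -/
open scoped BigOperators

noncomputable section

/-- If the exponential sums of `f` and `g` agree and `f = g` on `s`, then a lower bound of `g` on
the complement of `s` is also a lower bound of `f` there. -/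
theorem le_of_tsum_exp_eq {ι : Type*} {f g : ι → ℝ} {s : Set ι}
    (hf : ∀ y : ℝ, 0 < y → Summable fun i => Real.exp (-y * f i))
    (hg : ∀ y : ℝ, 0 < y → Summable fun i => Real.exp (-y * g i))
    (hfg : ∀ y : ℝ, 0 < y → ∑' i, Real.exp (-y * f i) = ∑' i, Real.exp (-y * g i))
    (hs : ∀ i ∈ s, f i = g i) {i : ι} (hi : i ∉ s) {m : ℝ} (hm : ∀ k ∉ s, m ≤ g k) :
    m ≤ f i := by
  by_contra! hlt
  have hcompl : ∀ y : ℝ, 0 < y → ∑' k : (sᶜ : Set ι), Real.exp (-y * f k) =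
      ∑' k : (sᶜ : Set ι), Real.exp (-y * g k) := by
    intro y hy
    have h1 := (hf y hy).tsum_subtype_add_tsum_subtype_compl s
    have h2 := (hg y hy).tsum_subtype_add_tsum_subtype_compl s
    have h3 : ∑' k : s, Real.exp (-y * f k) = ∑' k : s, Real.exp (-y * g k) :=
      tsum_congr fun k => by rw [hs k k.2]
    linarith [hfg y hy]
  set C := ∑' k : (sᶜ : Set ι), Real.exp (-1 * g k)
  have hbound : ∀ y : ℝ, 1 ≤ y → Real.exp (y * (m - f i)) ≤ Real.exp m * C := by
    intro y hy
    have hy0 : 0 < y := by linarith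
    have h1 : Real.exp (-y * f i) ≤ ∑' k : (sᶜ : Set ι), Real.exp (-y * f k) :=
      ((hf y hy0).subtype sᶜ).le_tsum (⟨i, hi⟩ : (sᶜ : Set ι)) fun _ _ => (Real.exp_pos _).le
    have h2 : ∑' k : (sᶜ : Set ι), Real.exp (-y * g k) ≤ Real.exp (-(y - 1) * m) * C := by
      rw [← tsum_mul_left]
      refine ((hg y hy0).subtype sᶜ).tsum_le_tsum (fun k => ?_)
        (((hg 1 one_pos).subtype sᶜ).mul_left _)
      rw [← Real.exp_add]
      exact Real.exp_le_exp.2 (by nlinarith [hm k k.2])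
    rw [hcompl y hy0] at h1
    calc Real.exp (y * (m - f i)) = Real.exp (y * m) * Real.exp (-y * f i) := by
          rw [← Real.exp_add]; ring_nf
      _ ≤ Real.exp (y * m) * (Real.exp (-(y - 1) * m) * C) := by gcongr; exact h1.trans h2
      _ = Real.exp m * C := by rw [← mul_assoc, ← Real.exp_add]; ring_nf
  have hd : 0 < m - f i := by linarith
  set y := max 1 (Real.exp m * C / (m - f i))
  have h1 := hbound y (le_max_left _ _)
  have h2 : Real.exp m * C ≤ y * (m - f i) := (div_le_iff₀ hd).1 (le_max_right _ _)
  linarith [Real.add_one_le_exp (y * (m - f i))]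

/-- Equality of the exponential sums of two functions agreeing on `s` forces their minima over
the complement of `s` to agree. -/
theorem eq_of_tsum_exp_eq {ι : Type*} {f g : ι → ℝ} (s : Set ι)
    (hf : ∀ y : ℝ, 0 < y → Summable fun i => Real.exp (-y * f i))
    (hg : ∀ y : ℝ, 0 < y → Summable fun i => Real.exp (-y * g i))
    (hfg : ∀ y : ℝ, 0 < y → ∑' i, Real.exp (-y * f i) = ∑' i, Real.exp (-y * g i))
    (hs : ∀ i ∈ s, f i = g i) {i : ι} (hi : i ∉ s) (hfi : ∀ k ∉ s, f i ≤ f k)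
    (hgi : ∀ k ∉ s, g i ≤ g k) : f i = g i :=
  le_antisymm
    (le_of_tsum_exp_eq hg hf (fun y hy => (hfg y hy).symm) (fun k hk => (hs k hk).symm) hi hfi)
    (le_of_tsum_exp_eq hf hg hfg hs hi hgi)

/-- The value at `v` of the binary form `a x² + 2 b x y + c y²`. -/
def binaryForm (a b c : ℝ) (v : Fin 2 → ℤ) : ℝ :=
  a * (v 0 : ℝ) ^ 2 + 2 * b * v 0 * v 1 + c * (v 1 : ℝ) ^ 2

theorem QF_eq_binaryForm {A : Matrix (Fin 2) (Fin 2) ℝ} (hA : A.IsSymm) (v : Fin 2 → ℤ) :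
    QF A (Zc v) = binaryForm (A 0 0) (A 0 1) (A 1 1) v := by
  have := hA.apply 0 1
  simp only [QF, Zc, binaryForm, Fin.sum_univ_two]
  rw [this]
  ring

theorem one_le_cast_sq {n : ℤ} (hn : n ≠ 0) : (1 : ℝ) ≤ (n : ℝ) ^ 2 := by
  have : 0 < n ^ 2 := by positivity
  exact_mod_cast this

theorem binaryForm_ge_of_mul_ne_zero {a b c : ℝ} (hb : 0 ≤ b) (hba : 2 * b ≤ a) (hac : a ≤ c)
    {v : Fin 2 → ℤ} (h0 : v 0 ≠ 0) (h1 : v 1 ≠ 0) : a - 2 * b + c ≤ binaryForm a b c v := by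
  have hx := one_le_cast_sq h0
  have hy := one_le_cast_sq h1
  unfold binaryForm
  nlinarith [mul_nonneg hb (sq_nonneg ((v 0 : ℝ) + v 1)),
    mul_nonneg (by linarith : 0 ≤ a - b) (sub_nonneg.2 hx),
    mul_nonneg (by linarith : 0 ≤ c - b) (sub_nonneg.2 hy)]

theorem binaryForm_ge_of_snd_ne_zero {a b c : ℝ} (hb : 0 ≤ b) (hba : 2 * b ≤ a) (hac : a ≤ c)
    {v : Fin 2 → ℤ} (h1 : v 1 ≠ 0) : c ≤ binaryForm a b c v := by
  by_cases h0 : v 0 = 0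
  · simp only [binaryForm, h0, Int.cast_zero]
    nlinarith [one_le_cast_sq h1]
  · linarith [binaryForm_ge_of_mul_ne_zero hb hba hac h0 h1]

theorem binaryForm_ge_of_ne_zero {a b c : ℝ} (hb : 0 ≤ b) (hba : 2 * b ≤ a) (hac : a ≤ c)
    {v : Fin 2 → ℤ} (hv : v ≠ 0) : a ≤ binaryForm a b c v := by
  by_cases h1 : v 1 = 0
  · have h0 : v 0 ≠ 0 := fun h0 => hv (by ext i; fin_cases i <;> simp [h0, h1])
    simp only [binaryForm, h1, Int.cast_zero]
    nlinarith [one_le_cast_sq h0]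
  · linarith [binaryForm_ge_of_snd_ne_zero hb hba hac h1]

/-- A reduced binary form is determined by its theta series. -/
theorem reduced_binaryForm_unique {a b c a' b' c' : ℝ}
    (hb : 0 ≤ b) (hba : 2 * b ≤ a) (hac : a ≤ c)
    (hb' : 0 ≤ b') (hba' : 2 * b' ≤ a') (hac' : a' ≤ c')
    (hf : ∀ y : ℝ, 0 < y → Summable fun v => Real.exp (-y * binaryForm a b c v))
    (hg : ∀ y : ℝ, 0 < y → Summable fun v => Real.exp (-y * binaryForm a' b' c' v))
    (hfg : ∀ y : ℝ, 0 < y → ∑' v, Real.exp (-y * binaryForm a b c v) =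
      ∑' v, Real.exp (-y * binaryForm a' b' c' v)) : a = a' ∧ b = b' ∧ c = c' := by
  have e1 : ∀ a b c : ℝ, binaryForm a b c ![1, 0] = a := by simp [binaryForm]
  have e2 : ∀ a b c : ℝ, binaryForm a b c ![0, 1] = c := by simp [binaryForm]
  have e3 : ∀ a b c : ℝ, binaryForm a b c ![1, -1] = a - 2 * b + c := by
    simp [binaryForm, sub_eq_add_neg]
  have ha : a = a' := by
    have := eq_of_tsum_exp_eq {v | v = 0} hf hg hfg (i := ![1, 0])
      (by rintro v rfl; simp [binaryForm]) (by simp)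
      (fun k hk => by rw [e1]; exact binaryForm_ge_of_ne_zero hb hba hac hk)
      (fun k hk => by rw [e1]; exact binaryForm_ge_of_ne_zero hb' hba' hac' hk)
    simpa only [e1] using this
  subst ha
  have hc : c = c' := by
    have := eq_of_tsum_exp_eq {v | v 1 = 0} hf hg hfg (i := ![0, 1])
      (fun v hv => by have hv : v 1 = 0 := hv; simp [binaryForm, hv]) (by simp)
      (fun k hk => by rw [e2]; exact binaryForm_ge_of_snd_ne_zero hb hba hac hk)
      (fun k hk => by rw [e2]; exact binaryForm_ge_of_snd_ne_zero hb' hba' hac' hk)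
    simpa only [e2] using this
  subst hc
  have hd := eq_of_tsum_exp_eq {v | v 0 = 0 ∨ v 1 = 0} hf hg hfg (i := ![1, -1])
    (by rintro v (hv | hv) <;> simp [binaryForm, hv]) (by simp)
    (fun k hk => by
      rw [e3]
      exact binaryForm_ge_of_mul_ne_zero hb hba hac (fun h => hk (.inl h)) (fun h => hk (.inr h)))
    (fun k hk => by
      rw [e3]
      exact binaryForm_ge_of_mul_ne_zero hb' hba' hac'
        (fun h => hk (.inl h)) (fun h => hk (.inr h)))
  simp only [e3] at hd
  exact ⟨rfl, by linarith, rfl⟩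

/-- The congruent matrix `ᵗT A T`. -/
def congruent (A : Matrix (Fin 2) (Fin 2) ℝ) (T : Matrix (Fin 2) (Fin 2) ℤ) :
    Matrix (Fin 2) (Fin 2) ℝ :=
  Matrix.transpose (T.map (Int.cast : ℤ → ℝ)) * A * T.map (Int.cast : ℤ → ℝ)

theorem congruent_mul (A : Matrix (Fin 2) (Fin 2) ℝ) (S T : Matrix (Fin 2) (Fin 2) ℤ) :
    congruent A (S * T) = congruent (congruent A S) T := by
  simp only [congruent, Matrix.map_mul_intCast, Matrix.transpose_mul, Matrix.mul_assoc]

theorem congruent_one (A : Matrix (Fin 2) (Fin 2) ℝ) : congruent A 1 = A := by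
  simp [congruent]

theorem isSymm_congruent {A : Matrix (Fin 2) (Fin 2) ℝ} (hA : A.IsSymm)
    (T : Matrix (Fin 2) (Fin 2) ℤ) : (congruent A T).IsSymm := by
  simp [Matrix.IsSymm, congruent, Matrix.transpose_mul, hA.eq, Matrix.mul_assoc]

theorem congruent_apply {A : Matrix (Fin 2) (Fin 2) ℝ} (hA : A.IsSymm)
    (T : Matrix (Fin 2) (Fin 2) ℤ) (i j : Fin 2) :
    congruent A T i j = A 0 0 * T 0 i * T 0 j + A 0 1 * (T 0 i * T 1 j + T 1 i * T 0 j) +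
      A 1 1 * T 1 i * T 1 j := by
  have := hA.apply 0 1
  simp only [congruent, Matrix.mul_apply, Fin.sum_univ_two, Matrix.transpose_apply,
    Matrix.map_apply, this]
  ring

theorem QF_congruent (A : Matrix (Fin 2) (Fin 2) ℝ) (T : Matrix (Fin 2) (Fin 2) ℤ)
    (v : Fin 2 → ℤ) : QF (congruent A T) (Zc v) = QF A (Zc (T.mulVec v)) := by
  simp only [QF, Zc, congruent, Matrix.mul_apply, Fin.sum_univ_two, Matrix.transpose_apply,
    Matrix.map_apply, Matrix.mulVec, dotProduct]
  push_cast
  ring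

theorem exists_pos_mul_le_binaryForm {A : Matrix (Fin 2) (Fin 2) ℝ} (hA : A.IsSymm)
    (hpos : A.PosDef) : ∃ k : ℝ, 0 < k ∧
      ∀ v : Fin 2 → ℤ, k * ((v 0 : ℝ) ^ 2 + (v 1 : ℝ) ^ 2) ≤
        binaryForm (A 0 0) (A 0 1) (A 1 1) v := by
  have hdet := hpos.det_pos
  rw [Matrix.det_fin_two, hA.apply 0 1] at hdet
  have h0 : 0 < A 0 0 := hpos.diag_pos
  have h1 : 0 < A 1 1 := hpos.diag_pos
  refine ⟨(A 0 0 * A 1 1 - A 0 1 * A 0 1) / (A 0 0 + A 1 1), by positivity, fun v => ?_⟩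
  rw [div_mul_eq_mul_div, div_le_iff₀ (by positivity)]
  unfold binaryForm
  nlinarith [sq_nonneg (A 0 0 * v 0 + A 0 1 * v 1), sq_nonneg (A 0 1 * v 0 + A 1 1 * v 1)]

theorem summable_exp_neg_mul_int_sq {k : ℝ} (hk : 0 < k) :
    Summable fun n : ℤ => Real.exp (-k * (n : ℝ) ^ 2) := by
  have hgeo : Summable fun n : ℕ => Real.exp (-k * (n : ℝ) ^ 2) := by
    refine (Real.summable_exp_nat_mul_iff.2 (neg_neg_of_pos hk)).of_nonneg_of_le
      (fun _ => (Real.exp_pos _).le) fun n => Real.exp_le_exp.2 ?_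
    have : (n : ℝ) ≤ (n : ℝ) ^ 2 := by exact_mod_cast Nat.le_self_pow two_ne_zero n
    nlinarith
  exact Summable.of_nat_of_neg (by simpa using hgeo) (by simpa using hgeo)

theorem summable_exp_QF {A : Matrix (Fin 2) (Fin 2) ℝ} (hA : A.IsSymm) (hpos : A.PosDef)
    {y : ℝ} (hy : 0 < y) : Summable fun v : Fin 2 → ℤ => Real.exp (-y * QF A (Zc v)) := by
  obtain ⟨k, hk, hle⟩ := exists_pos_mul_le_binaryForm hA hpos
  have h1 := summable_exp_neg_mul_int_sq (mul_pos hy hk)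
  have h2 := (h1.mul_of_nonneg h1 (fun _ => (Real.exp_pos _).le) fun _ => (Real.exp_pos _).le)
  refine Summable.of_nonneg_of_le (fun _ => (Real.exp_pos _).le) (fun v => ?_)
    ((finTwoArrowEquiv ℤ).summable_iff.2 h2)
  simp only [Function.comp_apply, finTwoArrowEquiv_apply, ← Real.exp_add, QF_eq_binaryForm hA]
  refine Real.exp_le_exp.2 ?_
  change -y * _ ≤ -(y * k) * (v 0 : ℝ) ^ 2 + -(y * k) * (v 1 : ℝ) ^ 2
  nlinarith [hle v]

theorem tsum_exp_QF_eq {A A' : Matrix (Fin 2) (Fin 2) ℝ}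
    (htheta : ∀ τ : ℂ, 0 < τ.im →
      ∑' c : Fin 2 → ℤ, eq2 (QF A (Zc c)) τ = ∑' c : Fin 2 → ℤ, eq2 (QF A' (Zc c)) τ)
    {y : ℝ} (hy : 0 < y) :
    ∑' v : Fin 2 → ℤ, Real.exp (-y * QF A (Zc v)) =
      ∑' v : Fin 2 → ℤ, Real.exp (-y * QF A' (Zc v)) := by
  have hexp : ∀ t : ℝ, eq2 t (((y / (2 * Real.pi) : ℝ) : ℂ) * Complex.I) =
      ((Real.exp (-y * t) : ℝ) : ℂ) := by
    intro t
    have hpi : (Real.pi : ℂ) ≠ 0 := by exact_mod_cast Real.pi_ne_zero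
    rw [eq2, Complex.ofReal_exp]
    congr 1
    push_cast
    field_simp
    rw [Complex.I_sq]
    ring
  have h := htheta (((y / (2 * Real.pi) : ℝ) : ℂ) * Complex.I) (by
    simp only [Complex.mul_I_im, Complex.ofReal_re]; positivity)
  simp only [hexp] at h
  exact_mod_cast h

/-- The action of `U ∈ GL₂(ℤ)` on `ℤ²`. -/
def mulVecEquiv (U : GL (Fin 2) ℤ) : (Fin 2 → ℤ) ≃ (Fin 2 → ℤ) where
  toFun v := (U : Matrix (Fin 2) (Fin 2) ℤ).mulVec v
  invFun v := ((U⁻¹ : GL (Fin 2) ℤ) : Matrix (Fin 2) (Fin 2) ℤ).mulVec v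
  left_inv v := by simp only [Matrix.mulVec_mulVec, Units.inv_mul, Matrix.one_mulVec]
  right_inv v := by simp only [Matrix.mulVec_mulVec, Units.mul_inv, Matrix.one_mulVec]

theorem tendsto_trace_congruent {A : Matrix (Fin 2) (Fin 2) ℝ} (hA : A.IsSymm)
    (hpos : A.PosDef) :
    Filter.Tendsto (fun U : GL (Fin 2) ℤ => (congruent A U).trace) Filter.cofinite
      Filter.atTop := by
  obtain ⟨k, hk, hle⟩ := exists_pos_mul_le_binaryForm hA hpos
  refine Filter.tendsto_atTop.2 fun C => Filter.eventually_cofinite.2 ?_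
  obtain ⟨N, hN⟩ := exists_nat_ge (C / k)
  have hfin : {M : Fin 2 → Fin 2 → ℤ | ∀ i j, M i j ∈ Set.Icc (-(N : ℤ)) N}.Finite := by
    have := Set.Finite.pi' fun _ : Fin 2 => Set.Finite.pi' fun _ : Fin 2 =>
      Set.finite_Icc (-(N : ℤ)) N
    exact this
  refine (hfin.preimage (f := fun U : GL (Fin 2) ℤ => fun i j => U.1 i j) ?_).subset ?_
  · intro U _ V _ h
    exact Units.ext h
  intro U hU i j
  have hU : (congruent A U).trace < C := not_le.1 hU
  have h0 := hle fun i => U.1 i 0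
  have h1 := hle fun i => U.1 i 1
  have htr : (congruent A U).trace = binaryForm (A 0 0) (A 0 1) (A 1 1) (fun i => U.1 i 0) +
      binaryForm (A 0 0) (A 0 1) (A 1 1) (fun i => U.1 i 1) := by
    simp only [Matrix.trace_fin_two, congruent_apply hA, binaryForm]
    ring
  have hCk : C ≤ N * k := (div_le_iff₀ hk).1 hN
  have hsum : (U.1 0 0 : ℝ) ^ 2 + (U.1 1 0 : ℝ) ^ 2 + (U.1 0 1 : ℝ) ^ 2 + (U.1 1 1 : ℝ) ^ 2 ≤
      N := by
    refine le_of_mul_le_mul_left ?_ hk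
    linarith
  have hij : U.1 i j ^ 2 ≤ (N : ℤ) := by
    have : (U.1 i j : ℝ) ^ 2 ≤ N := by
      fin_cases i <;> fin_cases j <;> simp only [Fin.zero_eta, Fin.mk_one] <;>
        nlinarith [sq_nonneg (U.1 0 0 : ℝ), sq_nonneg (U.1 1 0 : ℝ), sq_nonneg (U.1 0 1 : ℝ),
          sq_nonneg (U.1 1 1 : ℝ)]
    exact_mod_cast this
  have habs : |U.1 i j| ≤ U.1 i j ^ 2 := by
    simpa only [Int.natCast_natAbs] using Int.natAbs_le_self_sq (U.1 i j)
  exact Set.mem_Icc.2 (abs_le.1 (habs.trans hij))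

/-- Every positive definite binary form is `GL₂(ℤ)`-equivalent to a reduced one. -/
theorem exists_reduced {A : Matrix (Fin 2) (Fin 2) ℝ} (hA : A.IsSymm) (hpos : A.PosDef) :
    ∃ U : GL (Fin 2) ℤ, 0 ≤ congruent A U 0 1 ∧ 2 * congruent A U 0 1 ≤ congruent A U 0 0 ∧
      congruent A U 0 0 ≤ congruent A U 1 1 := by
  obtain ⟨U, hU⟩ := (tendsto_trace_congruent hA hpos).exists_forall_le
  have hB := isSymm_congruent hA U.1
  set B := congruent A U.1
  have hmul : ∀ V : GL (Fin 2) ℤ, congruent A (U * V : GL (Fin 2) ℤ).1 = congruent B V.1 :=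
    fun V => congruent_mul A U.1 V.1
  have hmin : ∀ V : GL (Fin 2) ℤ, B.trace ≤ (congruent B V.1).trace := fun V =>
    (hU (U * V)).trans_eq (by rw [hmul])
  have hlower : ∀ e : ℤ, 0 ≤ 2 * e * B 0 1 + e ^ 2 * B 1 1 := by
    intro e
    have := hmin ⟨!![1, 0; e, 1], !![1, 0; -e, 1],
      by simp [Matrix.one_fin_two], by simp [Matrix.one_fin_two]⟩
    simp [Matrix.trace_fin_two, congruent_apply hB] at this
    linarith
  have hupper : ∀ e : ℤ, 0 ≤ 2 * e * B 0 1 + e ^ 2 * B 0 0 := by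
    intro e
    have := hmin ⟨!![1, e; 0, 1], !![1, -e; 0, 1],
      by simp [Matrix.one_fin_two], by simp [Matrix.one_fin_two]⟩
    simp [Matrix.trace_fin_two, congruent_apply hB] at this
    linarith
  have l1 := hlower 1
  have l2 := hlower (-1)
  have u1 := hupper 1
  have u2 := hupper (-1)
  push_cast at l1 l2 u1 u2
  suffices ∃ V : GL (Fin 2) ℤ, 0 ≤ congruent B V.1 0 1 ∧
      2 * congruent B V.1 0 1 ≤ congruent B V.1 0 0 ∧
      congruent B V.1 0 0 ≤ congruent B V.1 1 1 by
    obtain ⟨V, hV⟩ := this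
    exact ⟨U * V, by rw [hmul]; exact hV⟩
  obtain ⟨e, he, hes⟩ : ∃ e : ℤ, e * e = 1 ∧ (e : ℝ) * B 0 1 = |B 0 1| := by
    rcases abs_choice (B 0 1) with h | h
    · exact ⟨1, by simp, by simp [h]⟩
    · exact ⟨-1, by simp, by simp [h]⟩
  have heR : (e : ℝ) * e = 1 := by exact_mod_cast he
  have habs0 : 2 * |B 0 1| ≤ B 0 0 := by
    have := abs_le.2 (⟨by linarith, by linarith⟩ : -(B 0 0 / 2) ≤ B 0 1 ∧ B 0 1 ≤ B 0 0 / 2)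
    linarith
  have habs1 : 2 * |B 0 1| ≤ B 1 1 := by
    have := abs_le.2 (⟨by linarith, by linarith⟩ : -(B 1 1 / 2) ≤ B 0 1 ∧ B 0 1 ≤ B 1 1 / 2)
    linarith
  have hnn := abs_nonneg (B 0 1)
  rcases le_total (B 0 0) (B 1 1) with h | h
  · refine ⟨⟨!![1, 0; 0, e], !![1, 0; 0, e], by simp [Matrix.one_fin_two, he],
      by simp [Matrix.one_fin_two, he]⟩, ?_⟩
    simp only [congruent_apply hB, Matrix.of_apply, Matrix.cons_val_zero, Matrix.cons_val_one,
      Matrix.cons_val', Matrix.cons_val_fin_one, Int.cast_zero, Int.cast_one]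
    refine ⟨by linarith, by linarith, by nlinarith⟩
  · refine ⟨⟨!![0, e; 1, 0], !![0, 1; e, 0], by simp [Matrix.one_fin_two, he],
      by simp [Matrix.one_fin_two, he]⟩, ?_⟩
    simp only [congruent_apply hB, Matrix.of_apply, Matrix.cons_val_zero, Matrix.cons_val_one,
      Matrix.cons_val', Matrix.cons_val_fin_one, Int.cast_zero, Int.cast_one]
    refine ⟨by linarith, by linarith, by nlinarith⟩

theorem summable_exp_binaryForm_congruent {A : Matrix (Fin 2) (Fin 2) ℝ} (hA : A.IsSymm)
    (hpos : A.PosDef) (U : GL (Fin 2) ℤ) {y : ℝ} (hy : 0 < y) :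
    Summable fun v => Real.exp (-y * binaryForm (congruent A U 0 0) (congruent A U 0 1)
      (congruent A U 1 1) v) := by
  simp only [← QF_eq_binaryForm (isSymm_congruent hA U.1), QF_congruent]
  exact (mulVecEquiv U).summable_iff.2 (summable_exp_QF hA hpos hy)

theorem tsum_exp_binaryForm_congruent {A : Matrix (Fin 2) (Fin 2) ℝ} (hA : A.IsSymm)
    (U : GL (Fin 2) ℤ) (y : ℝ) :
    ∑' v, Real.exp (-y * binaryForm (congruent A U 0 0) (congruent A U 0 1)
      (congruent A U 1 1) v) = ∑' v : Fin 2 → ℤ, Real.exp (-y * QF A (Zc v)) := by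
  simp only [← QF_eq_binaryForm (isSymm_congruent hA U.1), QF_congruent]
  exact (mulVecEquiv U).tsum_eq fun v => Real.exp (-y * QF A (Zc v))

/-- Global Torelli in rank two: if two positive definite real symmetric 2×2 matrices have
equal theta series on the upper half plane, then they are equivalent, i.e. there is
`T ∈ GL₂(ℤ)` with `A' = ᵗT A T`. -/
theorem global_torelli_rank_two
    (A A' : Matrix (Fin 2) (Fin 2) ℝ)
    (hAsym : A.IsSymm) (hApos : A.PosDef)
    (hA'sym : A'.IsSymm) (hA'pos : A'.PosDef)
    (htheta : ∀ τ : ℂ, 0 < τ.im →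
      ∑' c : Fin 2 → ℤ, eq2 (QF A (Zc c)) τ = ∑' c : Fin 2 → ℤ, eq2 (QF A' (Zc c)) τ) :
    ∃ T : Matrix (Fin 2) (Fin 2) ℤ, (T.det = 1 ∨ T.det = -1) ∧
      A' = Matrix.transpose (T.map (Int.cast : ℤ → ℝ)) * A * T.map (Int.cast : ℤ → ℝ) := by
  obtain ⟨U, hb, hba, hac⟩ := exists_reduced hAsym hApos
  obtain ⟨V, hb', hba', hac'⟩ := exists_reduced hA'sym hA'pos
  obtain ⟨h00, h01, h11⟩ := reduced_binaryForm_unique hb hba hac hb' hba' hac'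
    (fun y hy => summable_exp_binaryForm_congruent hAsym hApos U hy)
    (fun y hy => summable_exp_binaryForm_congruent hA'sym hA'pos V hy)
    (fun y hy => by
      rw [tsum_exp_binaryForm_congruent hAsym, tsum_exp_binaryForm_congruent hA'sym]
      exact tsum_exp_QF_eq htheta hy)
  have hUV : congruent A U.1 = congruent A' V.1 := by
    have h10 := (isSymm_congruent hAsym U.1).apply 0 1
    have h10' := (isSymm_congruent hA'sym V.1).apply 0 1
    ext i j
    fin_cases i <;> fin_cases j
    exacts [h00, h01, h10.trans (h01.trans h10'.symm), h11]
  refine ⟨(U * V⁻¹ : GL (Fin 2) ℤ).1, ?_, ?_⟩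
  · exact Int.isUnit_iff.1 ((Matrix.isUnit_iff_isUnit_det _).1 (U * V⁻¹ : GL (Fin 2) ℤ).isUnit)
  · change A' = congruent A (U.1 * (V⁻¹ : GL (Fin 2) ℤ).1)
    rw [congruent_mul, hUV, ← congruent_mul, Units.mul_inv, congruent_one]
end
end
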